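/- arXiv:2107.00748 — 9 statements merged into one kernel-verified Lean document; each statement's English description precedes it below -/
import Mathlib

section
/- Let T be a rooted binary phylogenetic X-tree with |X| ≥ 3 and strictly positive edge lengths, and suppose the ranking induced by FP_T is strict and reversible with respect to a subset X' ⊂ X (with induced subtree T̃ = T_{X∖X'}). Then for every cherry [x_i, x_j] of T, at least one of x_i, x_j belongs to X', i.e. |X' ∩ {x_i, x_j}| ≥ 1. -/
open scoped Classical

namespace Phylo

/-- A rooted binary phylogenetic tree with leaf labels of type `α`.
`node l r a b` is a tree whose root has two children: the roots of `l` and `r`,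
where `a` is the length of the edge to the root of `l` and `b` the length of the
edge to the root of `r`.  A tree `leaf x` consists of a single vertex labelled `x`. -/
inductive PhyloTree (α : Type) : Type where
  | leaf : α → PhyloTree α
  | node : PhyloTree α → PhyloTree α → ℝ → ℝ → PhyloTree α

namespace PhyloTree

variable {α : Type} [DecidableEq α]

/-- The set of leaf labels of a tree. -/
def leafSet : PhyloTree α → Finset α
  | leaf x => {x}
  | node l r _ _ => leafSet l ∪ leafSet r

/-- The number of leaves of a tree. -/
def numLeaves (T : PhyloTree α) : ℕ := T.leafSet.card

/-- All edge lengths of the tree are strictly positive. -/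
def posLengths : PhyloTree α → Prop
  | leaf _ => True
  | node l r a b => 0 < a ∧ 0 < b ∧ posLengths l ∧ posLengths r

/-- The leaves of the tree are bijectively labelled (no label occurs twice);
this makes `T` a phylogenetic `X`-tree with `X = T.leafSet`. -/
def distinctLeaves : PhyloTree α → Prop
  | leaf _ => True
  | node l r _ _ => Disjoint l.leafSet r.leafSet ∧ distinctLeaves l ∧ distinctLeaves r

/-- The Fair Proportion index `FP_T(x)`: every edge `e` on the path from the root to `x`
contributes `λ_e / D_e`, where `D_e` is the number of leaves descended from `e`. -/
noncomputable def FP : PhyloTree α → α → ℝ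
  | leaf _, _ => 0
  | node l r a b, x =>
    if x ∈ l.leafSet then FP l x + a / (l.numLeaves : ℝ)
    else if x ∈ r.leafSet then FP r x + b / (r.numLeaves : ℝ)
    else 0

/-- Helper for the induced subtree: `restrict? T Y` returns `none` if no leaf of `T`
survives, and otherwise `some (e, T')` where `T'` is the induced subtree on the
surviving leaves and `e` is the total length of the suppressed unary chain of edges
above the root of `T'` (merged edge lengths are added). -/
noncomputable def restrict? : PhyloTree α → Finset α → Option (ℝ × PhyloTree α)
  | leaf x, Y => if x ∈ Y then some (0, leaf x) else none
  | node l r a b, Y =>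
    match restrict? l Y, restrict? r Y with
    | some (ea, l'), some (eb, r') => some (0, node l' r' (a + ea) (b + eb))
    | some (ea, l'), none => some (a + ea, l')
    | none, some (eb, r') => some (b + eb, r')
    | none, none => none

/-- The induced subtree `T_Y` of `T` on the leaf set `Y` (non-root degree-2 vertices are
suppressed, merged edge lengths are added, and a dangling root edge is deleted).
Junk value `T` if no leaf survives. -/
noncomputable def restrictTree (T : PhyloTree α) (Y : Finset α) : PhyloTree α :=
  match T.restrict? Y with
  | some (_, t) => t
  | none => T

/-- The ranking induced by `FP_T` is strict: `FP_T` is injective on the leaf set. -/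
def strict (T : PhyloTree α) : Prop := Set.InjOn T.FP ↑T.leafSet

/-- The ranking induced by `FP_T` is reversible with respect to `X' ⊂ X`: writing
`T̃ = T_{X \ X'}`, for all surviving leaves `x, y` we have
`FP_T x > FP_T y ↔ FP_T̃ x < FP_T̃ y`. -/
def reversible (T : PhyloTree α) (X' : Finset α) : Prop :=
  ∀ x ∈ T.leafSet \ X', ∀ y ∈ T.leafSet \ X',
    (T.FP y < T.FP x ↔
      (T.restrictTree (T.leafSet \ X')).FP x < (T.restrictTree (T.leafSet \ X')).FP y)

/-- The cherries of `T`: pairs of leaves sharing the same parent. -/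
def cherries : PhyloTree α → Finset (α × α)
  | leaf _ => ∅
  | node (leaf x) (leaf y) _ _ => {(x, y)}
  | node l r _ _ => cherries l ∪ cherries r

/-- `X'` consists of precisely one leaf out of each cherry of `T`. -/
def oneLeafPerCherry (T : PhyloTree α) (X' : Finset α) : Prop :=
  (∀ x ∈ X', ∃ p ∈ T.cherries, x = p.1 ∨ x = p.2) ∧
  ∀ p ∈ T.cherries, (p.1 ∈ X' ∧ p.2 ∉ X') ∨ (p.1 ∉ X' ∧ p.2 ∈ X')

/-- Two trees have the same shape and the same leaf labelling
(only the edge lengths may differ). -/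
def sameShape : PhyloTree α → PhyloTree α → Prop
  | leaf x, leaf y => x = y
  | node l r _ _, node l' r' _ _ => sameShape l l' ∧ sameShape r r'
  | _, _ => False

/-- `T.hasSubtree s`: `s` occurs as a (pendant) subtree of `T`. -/
def hasSubtree : PhyloTree α → PhyloTree α → Prop
  | leaf x, s => leaf x = s
  | node l r a b, s => node l r a b = s ∨ hasSubtree l s ∨ hasSubtree r s

/-- The total edge length of the path from the root to the leaf `x`. -/
noncomputable def depth : PhyloTree α → α → ℝ
  | leaf _, _ => 0
  | node l r a b, x =>
    if x ∈ l.leafSet then depth l x + a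
    else if x ∈ r.leafSet then depth r x + b
    else 0

/-- `T` is ultrametric: all leaves have the same distance to the root. -/
def ultrametric (T : PhyloTree α) : Prop :=
  ∀ x ∈ T.leafSet, ∀ y ∈ T.leafSet, T.depth x = T.depth y

/-- The total sum of the edge lengths of `T`. -/
noncomputable def totalLength : PhyloTree α → ℝ
  | leaf _ => 0
  | node l r a b => a + b + totalLength l + totalLength r

/-- Whether the tree is a single leaf. -/
def isLeafB : PhyloTree α → Bool
  | leaf _ => true
  | node _ _ _ _ => false

/-- Multiply all edge lengths of `T` by `k`. -/
noncomputable def scale (k : ℝ) : PhyloTree α → PhyloTree α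
  | leaf x => leaf x
  | node l r a b => node (scale k l) (scale k r) (k * a) (k * b)

/-- Add `d` to the length of every pendant edge (edge incident to a leaf) of `T`. -/
noncomputable def addPendant (d : ℝ) : PhyloTree α → PhyloTree α
  | leaf x => leaf x
  | node l r a b =>
    node (addPendant d l) (addPendant d r)
      (if l.isLeafB then a + d else a) (if r.isLeafB then b + d else b)

end PhyloTree

end Phylo


namespace Phylo.PhyloTree

theorem aux_restrict_leafSet {α : Type} [DecidableEq α] (Y : Finset α) (T : PhyloTree α) :
    (T.restrict? Y = none → ∀ z ∈ T.leafSet, z ∉ Y) ∧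
    (∀ e T', T.restrict? Y = some (e, T') →
      ∀ z, z ∈ T'.leafSet ↔ z ∈ T.leafSet ∧ z ∈ Y) := by
  induction T with
  | leaf x =>
    constructor
    · intro h z hz
      simp only [leafSet, Finset.mem_singleton] at hz
      subst hz
      by_contra hy
      simp [restrict?, hy] at h
    · intro e T' h z
      by_cases hy : x ∈ Y
      · simp only [restrict?, hy, if_true, Option.some.injEq, Prod.mk.injEq] at h
        obtain ⟨-, rfl⟩ := h
        simp only [leafSet, Finset.mem_singleton]
        constructor
        · rintro rfl
          exact ⟨rfl, hy⟩
        · exact fun h => h.1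
      · simp [restrict?, hy] at h
  | node l r a b ihl ihr =>
    rcases hl : l.restrict? Y with _ | ⟨ea, l'⟩ <;>
    rcases hr : r.restrict? Y with _ | ⟨eb, r'⟩ <;>
    simp only [hl, hr, Option.some.injEq, Prod.mk.injEq, restrict?, leafSet, Finset.mem_union] at ihl ihr ⊢
    · refine ⟨fun _ z hz => ?_, by simp⟩
      rcases hz with hz | hz
      · exact ihl.1 trivial z hz
      · exact ihr.1 trivial z hz
    · refine ⟨by simp, ?_⟩
      rintro e T' ⟨-, rfl⟩ z
      have h1 := ihl.1 trivial z
      have h2 := ihr.2 eb r' ⟨rfl, rfl⟩ z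
      tauto
    · refine ⟨by simp, ?_⟩
      rintro e T' ⟨-, rfl⟩ z
      have h1 := ihr.1 trivial z
      have h2 := ihl.2 ea l' ⟨rfl, rfl⟩ z
      tauto
    · refine ⟨by simp, ?_⟩
      rintro e T' ⟨-, rfl⟩ z
      have h1 := ihl.2 ea l' ⟨rfl, rfl⟩ z
      have h2 := ihr.2 eb r' ⟨rfl, rfl⟩ z
      simp only [leafSet, Finset.mem_union]
      tauto

theorem aux_cherries {α : Type} [DecidableEq α] {l r : PhyloTree α} {a b : ℝ} {x y : α}
    (h : (x, y) ∈ (node l r a b).cherries) :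
    (l = leaf x ∧ r = leaf y) ∨ (x, y) ∈ l.cherries ∨ (x, y) ∈ r.cherries := by
  cases l <;> cases r <;> simp_all [cherries]

theorem aux_main {α : Type} [DecidableEq α] (Y : Finset α) {x y : α} (hx : x ∈ Y) (hy : y ∈ Y)
    (T : PhyloTree α) (hd : T.distinctLeaves) (hc : (x, y) ∈ T.cherries) :
    x ∈ T.leafSet ∧ y ∈ T.leafSet ∧ x ≠ y ∧ ∀ e T', T.restrict? Y = some (e, T') →
      T'.FP x - T'.FP y = T.FP x - T.FP y := by
  induction T with
  | leaf z => simp [cherries] at hc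
  | node l r a b ihl ihr =>
    obtain ⟨hdis, hdl, hdr⟩ := hd
    have Ll := aux_restrict_leafSet Y l
    have Lr := aux_restrict_leafSet Y r
    rcases aux_cherries hc with ⟨rfl, rfl⟩ | hc | hc
    · have hne : x ≠ y := by simpa [leafSet] using hdis
      refine ⟨by simp [leafSet], by simp [leafSet], hne, ?_⟩
      intro e T' h
      simp only [restrict?, hx, hy, if_true, Option.some.injEq, Prod.mk.injEq] at h
      obtain ⟨-, rfl⟩ := h
      simp [FP, leafSet, hne.symm, numLeaves]
    · obtain ⟨hxl, hyl, hne, H⟩ := ihl hdl hc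
      refine ⟨by simp [leafSet, hxl], by simp [leafSet, hyl], hne, ?_⟩
      intro e T' h
      rcases hl : l.restrict? Y with _ | ⟨ea, l'⟩
      · exact absurd hx (Ll.1 hl x hxl)
      · have H := H _ _ hl
        have hx' := (Ll.2 _ _ hl x).2 ⟨hxl, hx⟩
        have hy' := (Ll.2 _ _ hl y).2 ⟨hyl, hy⟩
        rcases hr : r.restrict? Y with _ | ⟨eb, r'⟩ <;>
        simp only [restrict?, hl, hr, Option.some.injEq, Prod.mk.injEq] at h <;>
        obtain ⟨-, rfl⟩ := h <;>
        simp only [FP, hxl, hyl, hx', hy', if_true] <;> linarith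
    · obtain ⟨hxr, hyr, hne, H⟩ := ihr hdr hc
      have hxl := Finset.disjoint_right.1 hdis hxr
      have hyl := Finset.disjoint_right.1 hdis hyr
      refine ⟨by simp [leafSet, hxr], by simp [leafSet, hyr], hne, ?_⟩
      intro e T' h
      rcases hr : r.restrict? Y with _ | ⟨eb, r'⟩
      · exact absurd hx (Lr.1 hr x hxr)
      · have H := H _ _ hr
        have hx' := (Lr.2 _ _ hr x).2 ⟨hxr, hx⟩
        have hy' := (Lr.2 _ _ hr y).2 ⟨hyr, hy⟩
        rcases hl : l.restrict? Y with _ | ⟨ea, l'⟩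
        · simp only [restrict?, hl, hr, Option.some.injEq, Prod.mk.injEq] at h
          obtain ⟨-, rfl⟩ := h
          simp only [FP, hxl, hyl, hxr, hyr, if_true, if_false]
          linarith
        · have hx'' : x ∉ l'.leafSet := fun h => hxl ((Ll.2 _ _ hl x).1 h).1
          have hy'' : y ∉ l'.leafSet := fun h => hyl ((Ll.2 _ _ hl y).1 h).1
          simp only [restrict?, hl, hr, Option.some.injEq, Prod.mk.injEq] at h
          obtain ⟨-, rfl⟩ := h
          simp only [FP, hxl, hyl, hxr, hyr, hx', hy', hx'', hy'', if_true, if_false]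
          linarith

theorem aux_mem {α : Type} [DecidableEq α] {x y : α}
    (T : PhyloTree α) (hc : (x, y) ∈ T.cherries) : x ∈ T.leafSet ∧ y ∈ T.leafSet := by
  induction T with
  | leaf z => simp [cherries] at hc
  | node l r a b ihl ihr =>
    simp only [leafSet, Finset.mem_union]
    rcases aux_cherries hc with ⟨rfl, rfl⟩ | hc | hc
    · simp [leafSet]
    · exact ⟨Or.inl (ihl hc).1, Or.inl (ihl hc).2⟩
    · exact ⟨Or.inr (ihr hc).1, Or.inr (ihr hc).2⟩

end Phylo.PhyloTree

open Phylo PhyloTree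

/-- If the ranking induced by `FP_T` is strict and reversible with respect to
`X' ⊂ X`, then every cherry `[xi, xj]` of `T` meets `X'`. -/
theorem reversible_ranking_meets_every_cherry {α : Type} [DecidableEq α]
    (T : PhyloTree α) (hleaf : T.distinctLeaves) (hpos : T.posLengths)
    (hn : 3 ≤ T.numLeaves)
    (X' : Finset α) (hX' : X' ⊂ T.leafSet)
    (hstrict : T.strict) (hrev : T.reversible X')
    (xi xj : α) (hcherry : (xi, xj) ∈ T.cherries) :
    xi ∈ X' ∨ xj ∈ X' := by
  by_contra hcon
  push Not at hcon
  obtain ⟨hi, hj⟩ := hcon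
  obtain ⟨mi, mj⟩ := aux_mem T hcherry
  have hYi : xi ∈ T.leafSet \ X' := Finset.mem_sdiff.2 ⟨mi, hi⟩
  have hYj : xj ∈ T.leafSet \ X' := Finset.mem_sdiff.2 ⟨mj, hj⟩
  obtain ⟨-, -, hne, H⟩ := aux_main (T.leafSet \ X') hYi hYj T hleaf hcherry
  have hF : T.FP xi ≠ T.FP xj := fun h => hne (hstrict mi mj h)
  have h1 := hrev xi hYi xj hYj
  have h2 := hrev xj hYj xi hYi
  have key : (T.restrictTree (T.leafSet \ X')).FP xi - (T.restrictTree (T.leafSet \ X')).FP xj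
      = T.FP xi - T.FP xj := by
    unfold restrictTree
    rcases hr : T.restrict? (T.leafSet \ X') with _ | ⟨e, T'⟩
    · rfl
    · exact H _ _ hr
  rcases lt_or_gt_of_ne hF with h | h
  · have := h2.1 h
    linarith
  · have := h1.1 h
    linarith
end

section
/- Let T be a rooted binary phylogenetic X-tree with strictly positive edge lengths, let [x_i, x_j] be a cherry of T with parent w and pendant edges e_i = (w, x_i) and e_j = (w, x_j), and let X' ⊂ X with x_i, x_j ∉ X'. Let T̃ = T_{X∖X'} be the induced subtree. Then FP_T(x_i) − FP_T(x_j) = λ_{e_i} − λ_{e_j} = FP_{T̃}(x_i) − FP_{T̃}(x_j). -/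
open scoped Classical

open Phylo PhyloTree

theorem leafSet_of_hasSubtree {α : Type} [DecidableEq α] (s : PhyloTree α) :
    ∀ T : PhyloTree α, T.hasSubtree s → s.leafSet ⊆ T.leafSet
  | .leaf x, h => by
    simp only [hasSubtree] at h
    rw [h]
  | .node l r a b, h => by
    simp only [hasSubtree] at h
    rcases h with h | h | h
    · rw [h]
    · exact (leafSet_of_hasSubtree s l h).trans (by simp [leafSet])
    · exact (leafSet_of_hasSubtree s r h).trans (by simp [leafSet])

theorem fp_cherry_aux {α : Type} [DecidableEq α] (xi xj : α) (li lj : ℝ) :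
    ∀ T : PhyloTree α, T.distinctLeaves →
    T.hasSubtree (.node (.leaf xi) (.leaf xj) li lj) → T.FP xi - T.FP xj = li - lj
  | .leaf x, _, h => by simp [hasSubtree] at h
  | .node l r a b, hd, h => by
    simp only [hasSubtree] at h
    simp only [distinctLeaves] at hd
    obtain ⟨hd, hl, hr⟩ := hd
    rcases h with h | h | h
    · injection h with h1 h2 h3 h4
      subst h1 h2 h3 h4
      have hne : xj ≠ xi := by
        rintro rfl
        simp [leafSet] at hd
      simp [FP, leafSet, numLeaves, hne]
    · have hs := leafSet_of_hasSubtree _ _ h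
      have h1 : xi ∈ l.leafSet := hs (by simp [leafSet])
      have h2 : xj ∈ l.leafSet := hs (by simp [leafSet])
      have := fp_cherry_aux xi xj li lj l hl h
      simp only [FP, h1, h2, if_true]
      linarith
    · have hs := leafSet_of_hasSubtree _ _ h
      have h1 : xi ∈ r.leafSet := hs (by simp [leafSet])
      have h2 : xj ∈ r.leafSet := hs (by simp [leafSet])
      have h1' : xi ∉ l.leafSet := fun h' => Finset.disjoint_left.1 hd h' h1
      have h2' : xj ∉ l.leafSet := fun h' => Finset.disjoint_left.1 hd h' h2
      have := fp_cherry_aux xi xj li lj r hr h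
      simp only [FP, h1, h2, h1', h2', if_true, if_false]
      linarith

theorem restrict_distinct {α : Type} [DecidableEq α] (Y : Finset α) :
    ∀ T : PhyloTree α, T.distinctLeaves → ∀ e t, T.restrict? Y = some (e, t) →
      t.distinctLeaves ∧ t.leafSet ⊆ T.leafSet
  | .leaf x, _, e, t, h => by
    simp only [restrict?] at h
    split_ifs at h
    simp only [Option.some.injEq, Prod.mk.injEq] at h
    obtain ⟨_, rfl⟩ := h
    simp [distinctLeaves]
  | .node l r a b, hd, e, t, h => by
    simp only [distinctLeaves] at hd
    obtain ⟨hd, hl, hr⟩ := hd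
    have il := restrict_distinct Y l hl
    have ir := restrict_distinct Y r hr
    simp only [restrict?] at h
    rcases hL : l.restrict? Y with _ | ⟨ea, l'⟩ <;>
    rcases hR : r.restrict? Y with _ | ⟨eb, r'⟩ <;>
    simp only [hL, hR, Option.some.injEq, Prod.mk.injEq, reduceCtorEq] at h
    · obtain ⟨_, rfl⟩ := h
      obtain ⟨h1, h2⟩ := ir _ _ hR
      exact ⟨h1, h2.trans (by simp [leafSet])⟩
    · obtain ⟨_, rfl⟩ := h
      obtain ⟨h1, h2⟩ := il _ _ hL
      exact ⟨h1, h2.trans (by simp [leafSet])⟩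
    · obtain ⟨_, rfl⟩ := h
      obtain ⟨h1, h2⟩ := ir _ _ hR
      obtain ⟨h3, h4⟩ := il _ _ hL
      simp only [distinctLeaves, leafSet]
      exact ⟨⟨Finset.disjoint_of_subset_left h4 (Finset.disjoint_of_subset_right h2 hd), h3, h1⟩,
        Finset.union_subset_union h4 h2⟩

theorem restrict_cherry {α : Type} [DecidableEq α] (Y : Finset α) (xi xj : α) (li lj : ℝ)
    (hi : xi ∈ Y) (hj : xj ∈ Y) :
    ∀ T : PhyloTree α, T.hasSubtree (.node (.leaf xi) (.leaf xj) li lj) →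
      ∃ e t, T.restrict? Y = some (e, t) ∧ t.hasSubtree (.node (.leaf xi) (.leaf xj) li lj)
  | .leaf x, h => by simp [hasSubtree] at h
  | .node l r a b, h => by
    simp only [hasSubtree] at h
    rcases h with h | h | h
    · injection h with h1 h2 h3 h4
      subst h1 h2 h3 h4
      simp [restrict?, hi, hj, hasSubtree]
    · obtain ⟨e, t, h1, h2⟩ := restrict_cherry Y xi xj li lj hi hj l h
      rcases hR : r.restrict? Y with _ | ⟨eb, r'⟩
      · exact ⟨a + e, t, by simp [restrict?, h1, hR], h2⟩
      · exact ⟨0, .node t r' (a + e) (b + eb), by simp [restrict?, h1, hR], Or.inr (Or.inl h2)⟩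
    · obtain ⟨e, t, h1, h2⟩ := restrict_cherry Y xi xj li lj hi hj r h
      rcases hL : l.restrict? Y with _ | ⟨ea, l'⟩
      · exact ⟨b + e, t, by simp [restrict?, h1, hL], h2⟩
      · exact ⟨0, .node l' t (a + ea) (b + e), by simp [restrict?, h1, hL], Or.inr (Or.inr h2)⟩

/-- For a cherry `[xi, xj]` of `T` with pendant edge lengths `li, lj`,
none of whose leaves is deleted, the difference of FP indices equals `li - lj`,
both before and after the deletion of `X'`. -/
theorem fp_cherry_difference_invariant {α : Type} [DecidableEq α]
    (T : PhyloTree α) (hleaf : T.distinctLeaves) (hpos : T.posLengths)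
    (xi xj : α) (li lj : ℝ)
    (hcherry : T.hasSubtree (PhyloTree.node (PhyloTree.leaf xi) (PhyloTree.leaf xj) li lj))
    (X' : Finset α) (hX' : X' ⊂ T.leafSet)
    (hxi : xi ∉ X') (hxj : xj ∉ X') :
    T.FP xi - T.FP xj = li - lj ∧
    li - lj =
      (T.restrictTree (T.leafSet \ X')).FP xi - (T.restrictTree (T.leafSet \ X')).FP xj := by
  have hs := leafSet_of_hasSubtree _ _ hcherry
  have h1 : xi ∈ T.leafSet \ X' := Finset.mem_sdiff.2 ⟨hs (by simp [leafSet]), hxi⟩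
  have h2 : xj ∈ T.leafSet \ X' := Finset.mem_sdiff.2 ⟨hs (by simp [leafSet]), hxj⟩
  obtain ⟨e, t, ht, hc⟩ := restrict_cherry _ xi xj li lj h1 h2 T hcherry
  refine ⟨fp_cherry_aux xi xj li lj T hleaf hcherry, ?_⟩
  have hE : T.restrictTree (T.leafSet \ X') = t := by simp only [restrictTree, ht]
  rw [hE]
  exact (fp_cherry_aux xi xj li lj t (restrict_distinct _ T hleaf e t ht).1 hc).symm
end

section
/- Let n ≥ 2 and let T be a rooted binary phylogenetic X-tree with |X| = n, and let T̃ be the induced subtree on the leaf set X̃ ⊂ X that results from T when one leaf out of each cherry of T is deleted. Then there exist strictly positive edge lengths λ_1, …, λ_{2n−2} for T such that the ranking induced by FP_T is strict and reversible with respect to T̃, the leaf attaining the maximal FP_T value belongs to X̃, and the leaf attaining the minimal FP_T value does not belong to X̃. In particular, with c_T the number of cherries of T, the leaves can be ordered so that FP_T(x_1) > FP_T(x_2) > … > FP_T(x_n), with x_1 ∈ X̃, and for the retained leaves x_1, x̃_2, …, x̃_{n−c_T} one has FP_{T̃}(x_1) < FP_{T̃}(x̃_2) < … < FP_{T̃}(x̃_{n−c_T}),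 where FP_T(x̃_i) > FP_T(x̃_j) if and only if FP_{T̃}(x̃_i) < FP_{T̃}(x̃_j), and x_n ∉ X̃. -/
open scoped Classical

open Phylo PhyloTree

namespace Phylo
namespace PhyloTree

variable {α : Type} [DecidableEq α]

def PCore (T : PhyloTree α) (Y : Finset α) (A G : α → ℝ) : Prop :=
  ∀ p : α → ℝ, (∀ x ∈ T.leafSet, 0 < p x) → ∃ T' : PhyloTree α, T.sameShape T' ∧ T'.posLengths ∧
    (∀ x ∈ T.leafSet, T'.FP x = A x + p x) ∧
    ∃ e t, T'.restrict? Y = some (e, t) ∧ t.leafSet = T.leafSet ∩ Y ∧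
      ∀ x ∈ T.leafSet ∩ Y, t.FP x + e / (t.numLeaves : ℝ) = A x + G x + p x

def PPlant (T : PhyloTree α) (Y : Finset α) (A G : α → ℝ) : Prop :=
  ∀ p : α → ℝ, (∀ x ∈ T.leafSet, 0 < p x) → ∃ T' : PhyloTree α, ∃ a : ℝ, 0 < a ∧
    T.sameShape T' ∧ T'.posLengths ∧
    (∀ x ∈ T.leafSet, T'.FP x + a / (T.numLeaves : ℝ) = A x + p x) ∧
    ∃ e t, T'.restrict? Y = some (e, t) ∧ t.leafSet = T.leafSet ∩ Y ∧
      ∀ x ∈ T.leafSet ∩ Y, t.FP x + (a + e) / (t.numLeaves : ℝ) = A x + G x + p x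

theorem sameShape_leafSet : ∀ (T T' : PhyloTree α), T.sameShape T' → T'.leafSet = T.leafSet
  | leaf x, leaf y, h => by simp [sameShape] at h; simp [leafSet, h]
  | leaf x, node _ _ _ _, h => by simp [sameShape] at h
  | node _ _ _ _, leaf _, h => by simp [sameShape] at h
  | node l r _ _, node l' r' _ _, h => by
      simp only [sameShape] at h
      simp only [leafSet]
      rw [sameShape_leafSet l l' h.1, sameShape_leafSet r r' h.2]

theorem sameShape_distinct : ∀ (T T' : PhyloTree α), T.sameShape T' → T.distinctLeaves →
    T'.distinctLeaves
  | leaf x, leaf y, h, _ => by simp [distinctLeaves]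
  | leaf x, node _ _ _ _, h, _ => by simp [sameShape] at h
  | node _ _ _ _, leaf _, h, _ => by simp [sameShape] at h
  | node l r _ _, node l' r' _ _, h, hd => by
      simp only [sameShape] at h
      simp only [distinctLeaves] at hd ⊢
      rw [sameShape_leafSet l l' h.1, sameShape_leafSet r r' h.2]
      exact ⟨hd.1, sameShape_distinct l l' h.1 hd.2.1, sameShape_distinct r r' h.2 hd.2.2⟩

theorem cherries_node (l r : PhyloTree α) (a b : ℝ) (h : ¬ (l.isLeafB = true ∧ r.isLeafB = true)) :
    (node l r a b).cherries = l.cherries ∪ r.cherries := by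
  cases l <;> cases r <;> simp_all [cherries, isLeafB]

theorem cherries_mem (T : PhyloTree α) : ∀ p ∈ T.cherries, p.1 ∈ T.leafSet ∧ p.2 ∈ T.leafSet := by
  induction T with
  | leaf x => simp [cherries]
  | node l r a b ihl ihr =>
    intro p hp
    by_cases h : l.isLeafB = true ∧ r.isLeafB = true
    · cases l <;> cases r <;> simp_all [cherries, isLeafB, leafSet]
    · rw [cherries_node l r a b h, Finset.mem_union] at hp
      simp only [leafSet, Finset.mem_union]
      rcases hp with hp | hp
      · exact ⟨Or.inl (ihl p hp).1, Or.inl (ihl p hp).2⟩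
      · exact ⟨Or.inr (ihr p hp).1, Or.inr (ihr p hp).2⟩

theorem plant_leaf (x : α) (Y : Finset α) (hx : x ∈ Y) :
    PPlant (leaf x) Y (fun _ => 0) (fun _ => 0) := by
  intro p hp
  refine ⟨leaf x, p x, hp x (by simp [leafSet]), by simp [sameShape], by simp [posLengths], ?_,
    0, leaf x, by simp [restrict?, hx], ?_, ?_⟩
  · simp [leafSet, FP, numLeaves]
  · ext y; simp only [leafSet, Finset.mem_singleton, Finset.mem_inter]
    constructor
    · rintro rfl; exact ⟨rfl, hx⟩
    · exact fun h => h.1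
  · intro y hy
    simp only [leafSet, Finset.mem_singleton, Finset.mem_inter] at hy
    simp [leafSet, FP, numLeaves, hy.1]

theorem plant_core (T : PhyloTree α) (Y : Finset α) (A G : α → ℝ) (h : PCore T Y A G)
    (hi : Set.InjOn G ↑(T.leafSet ∩ Y)) (h1 : ∃ x ∈ T.leafSet, x ∈ Y)
    (h2 : ∃ x ∈ T.leafSet, x ∉ Y) (c : ℝ) :
    ∃ A' G', PPlant T Y A' G' ∧ Set.InjOn G' ↑(T.leafSet ∩ Y) ∧
      ∀ x ∈ T.leafSet ∩ Y, c < G' x := by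
  obtain ⟨x1, h1, h1'⟩ := h1
  obtain ⟨x2, h2, h2'⟩ := h2
  have hlt : (T.leafSet ∩ Y).card < T.leafSet.card := by
    apply Finset.card_lt_card
    refine ⟨Finset.inter_subset_left, fun hs => h2' (Finset.mem_inter.1 (hs h2)).2⟩
  have hpos : 0 < (T.leafSet ∩ Y).card := Finset.card_pos.2 ⟨x1, Finset.mem_inter.2 ⟨h1, h1'⟩⟩
  obtain ⟨x0, -, hx0⟩ := Finset.exists_min_image (T.leafSet ∩ Y) G ⟨x1, Finset.mem_inter.2 ⟨h1, h1'⟩⟩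
  set k : ℝ := 1 / ((T.leafSet ∩ Y).card : ℝ) - 1 / (T.leafSet.card : ℝ) with hk
  have hkpos : 0 < k := by
    rw [hk, sub_pos]
    apply one_div_lt_one_div_of_lt
    · exact_mod_cast hpos
    · exact_mod_cast hlt
  obtain ⟨a, ha, hac⟩ : ∃ a : ℝ, 0 < a ∧ c - G x0 < a * k := by
    refine ⟨max 1 ((c - G x0 + 1) / k), by positivity, ?_⟩
    calc c - G x0 < c - G x0 + 1 := by linarith
      _ = (c - G x0 + 1) / k * k := by field_simp
      _ ≤ _ := by gcongr; exact le_max_right _ _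
  refine ⟨fun x => A x + a / (T.leafSet.card : ℝ), fun x => G x + a * k, ?_, ?_, ?_⟩
  · intro p hp
    obtain ⟨T', hs, hpo, hf, e, t, hr, ht, hft⟩ := h p hp
    refine ⟨T', a, ha, hs, hpo, ?_, e, t, hr, ht, ?_⟩
    · intro x hx
      rw [hf x hx, numLeaves]; ring
    · intro x hx
      have := hft x hx
      rw [add_div, numLeaves, ht] at *
      rw [hk]
      linear_combination this
  · intro x hx y hy hxy
    exact hi hx hy (by simpa using hxy)
  · intro x hx
    have := hx0 x hx
    simp only
    linarith

theorem core_join (l r : PhyloTree α) (a b : ℝ) (Y : Finset α) (Al Gl Ar Gr : α → ℝ)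
    (hd : Disjoint l.leafSet r.leafSet) (hl : PPlant l Y Al Gl) (hr : PPlant r Y Ar Gr) :
    PCore (node l r a b) Y (fun x => if x ∈ l.leafSet then Al x else Ar x)
      (fun x => if x ∈ l.leafSet then Gl x else Gr x) := by
  intro p hp
  obtain ⟨l', a', ha, hsl, hpl, hfl, el, tl, hrl, htl, hftl⟩ :=
    hl p (fun x hx => hp x (by simp [leafSet, hx]))
  obtain ⟨r', b', hb, hsr, hpr, hfr, er, tr, hrr, htr, hftr⟩ :=
    hr p (fun x hx => hp x (by simp [leafSet, hx]))
  have el' := sameShape_leafSet _ _ hsl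
  have er' := sameShape_leafSet _ _ hsr
  refine ⟨node l' r' a' b', ⟨hsl, hsr⟩, ⟨ha, hb, hpl, hpr⟩, ?_, 0, node tl tr (a' + el) (b' + er), ?_,
    ?_, ?_⟩
  · intro x hx
    simp only [leafSet, Finset.mem_union] at hx
    by_cases hxl : x ∈ l.leafSet
    · simp only [FP, el', hxl, if_true, numLeaves]
      exact hfl x hxl
    · have hxr := hx.resolve_left hxl
      simp only [FP, el', er', hxl, hxr, if_true, if_false, numLeaves]
      exact hfr x hxr
  · simp [restrict?, hrl, hrr]
  · simp only [leafSet, htl, htr]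
    rw [Finset.union_inter_distrib_right]
  · intro x hx
    simp only [leafSet, Finset.mem_union, Finset.mem_inter] at hx
    obtain ⟨hx, hxY⟩ := hx
    by_cases hxl : x ∈ l.leafSet
    · have := hftl x (Finset.mem_inter.2 ⟨hxl, hxY⟩)
      simp only [FP, htl, hxl, hxY, if_true, numLeaves, Finset.mem_inter, and_self] at *
      rw [zero_div]; linarith
    · have hxr := hx.resolve_left hxl
      have := hftr x (Finset.mem_inter.2 ⟨hxr, hxY⟩)
      simp only [FP, htl, htr, hxl, hxr, hxY, if_true, if_false, numLeaves, Finset.mem_inter,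
        and_self, false_and] at *
      rw [zero_div]; linarith

theorem inj_join (l r : PhyloTree α) (a b : ℝ) (Y : Finset α) (Gl Gr : α → ℝ)
    (hl : Set.InjOn Gl ↑(l.leafSet ∩ Y)) (hr : Set.InjOn Gr ↑(r.leafSet ∩ Y))
    (hne : ∀ x ∈ l.leafSet ∩ Y, ∀ y ∈ r.leafSet ∩ Y, Gl x ≠ Gr y) :
    Set.InjOn (fun x => if x ∈ l.leafSet then Gl x else Gr x)
      ↑((node l r a b).leafSet ∩ Y) := by
  intro x hx y hy hxy
  simp only [leafSet, Finset.mem_coe, Finset.mem_union, Finset.mem_inter] at hx hy hne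
  simp only at hxy
  by_cases h1 : x ∈ l.leafSet <;> by_cases h2 : y ∈ l.leafSet <;> simp only [h1, h2, if_true, if_false] at hxy
  · exact hl (by simp [h1, hx.2]) (by simp [h2, hy.2]) hxy
  · exact absurd hxy (hne x ⟨h1, hx.2⟩ y ⟨hy.1.resolve_left h2, hy.2⟩)
  · exact absurd hxy.symm (hne y ⟨h2, hy.2⟩ x ⟨hx.1.resolve_left h1, hx.2⟩)
  · exact hr (by simp [hx.1.resolve_left h1, hx.2]) (by simp [hy.1.resolve_left h2, hy.2]) hxy

theorem core_cherry (x y : α) (a b : ℝ) (Y : Finset α) (hxy : x ≠ y)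
    (h : (x ∈ Y ∧ y ∉ Y) ∨ (x ∉ Y ∧ y ∈ Y)) :
    PCore (node (leaf x) (leaf y) a b) Y (fun _ => 0) (fun _ => 0) := by
  intro p hp
  have hpx := hp x (by simp [leafSet])
  have hpy := hp y (by simp [leafSet])
  refine ⟨node (leaf x) (leaf y) (p x) (p y), by simp [sameShape], by simp [posLengths, hpx, hpy],
    ?_, ?_⟩
  · intro z hz
    simp only [leafSet, Finset.mem_union, Finset.mem_singleton] at hz
    rcases hz with rfl | rfl
    · simp [FP, leafSet, numLeaves]
    · simp [FP, leafSet, numLeaves, hxy.symm]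
  · rcases h with ⟨h1, h2⟩ | ⟨h1, h2⟩
    · refine ⟨p x, leaf x, by simp [restrict?, h1, h2], ?_, ?_⟩
      · ext z; simp only [leafSet, Finset.mem_union, Finset.mem_singleton, Finset.mem_inter]
        grind
      · intro z hz
        simp only [leafSet, Finset.mem_union, Finset.mem_singleton, Finset.mem_inter] at hz
        have : z = x := by grind
        simp [FP, leafSet, numLeaves, this]
    · refine ⟨p y, leaf y, by simp [restrict?, h1, h2], ?_, ?_⟩
      · ext z; simp only [leafSet, Finset.mem_union, Finset.mem_singleton, Finset.mem_inter]
        grind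
      · intro z hz
        simp only [leafSet, Finset.mem_union, Finset.mem_singleton, Finset.mem_inter] at hz
        have : z = y := by grind
        simp [FP, leafSet, numLeaves, this]

theorem exists_core (Y : Finset α) (T : PhyloTree α) : T.distinctLeaves →
    (∀ x ∈ T.leafSet, x ∉ Y → ∃ p ∈ T.cherries, x = p.1 ∨ x = p.2) →
    (∀ p ∈ T.cherries, (p.1 ∈ Y ∧ p.2 ∉ Y) ∨ (p.1 ∉ Y ∧ p.2 ∈ Y)) →
    (∃ x, T = leaf x ∧ x ∈ Y) ∨
    ((∃ x ∈ T.leafSet, x ∈ Y) ∧ (∃ x ∈ T.leafSet, x ∉ Y) ∧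
      ∃ A G, PCore T Y A G ∧ Set.InjOn G ↑(T.leafSet ∩ Y)) := by
  induction T with
  | leaf x =>
    intro _ h _
    left
    refine ⟨x, rfl, ?_⟩
    by_contra hx
    simpa [cherries] using h x (by simp [leafSet]) hx
  | node l r a b ihl ihr =>
    intro hd h1 h2
    right
    simp only [distinctLeaves] at hd
    obtain ⟨hd, hdl, hdr⟩ := hd
    by_cases h : l.isLeafB = true ∧ r.isLeafB = true
    · cases l with
      | node _ _ _ _ => simp [isLeafB] at h
      | leaf x =>
      cases r with
      | node _ _ _ _ => simp [isLeafB] at h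
      | leaf y =>
      have hxy : x ≠ y := by simpa [leafSet] using hd
      have h3 := h2 (x, y) (by simp [cherries])
      simp only at h3
      refine ⟨?_, ?_, _, _, core_cherry x y a b Y hxy h3, ?_⟩
      · rcases h3 with h3 | h3
        · exact ⟨x, by simp [leafSet], h3.1⟩
        · exact ⟨y, by simp [leafSet], h3.2⟩
      · rcases h3 with h3 | h3
        · exact ⟨y, by simp [leafSet], h3.2⟩
        · exact ⟨x, by simp [leafSet], h3.1⟩
      · intro u hu v hv _
        simp only [leafSet, Finset.mem_union, Finset.mem_singleton, Finset.mem_inter,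
          Finset.mem_coe] at hu hv
        grind
    · rw [cherries_node l r a b h] at h1 h2
      have hL := ihl hdl (by
        intro x hx hxY
        obtain ⟨p, hp, hpx⟩ := h1 x (by simp [leafSet, hx]) hxY
        rcases Finset.mem_union.1 hp with hp | hp
        · exact ⟨p, hp, hpx⟩
        · exfalso
          have := cherries_mem r p hp
          refine Finset.disjoint_left.1 hd hx ?_
          rcases hpx with rfl | rfl
          exacts [this.1, this.2]) (fun p hp => h2 p (Finset.mem_union_left _ hp))
      have hR := ihr hdr (by
        intro x hx hxY
        obtain ⟨p, hp, hpx⟩ := h1 x (by simp [leafSet, hx]) hxY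
        rcases Finset.mem_union.1 hp with hp | hp
        · exfalso
          have := cherries_mem l p hp
          refine Finset.disjoint_left.1 hd ?_ hx
          rcases hpx with rfl | rfl
          exacts [this.1, this.2]
        · exact ⟨p, hp, hpx⟩) (fun p hp => h2 p (Finset.mem_union_right _ hp))
      rcases hL with ⟨x, rfl, hx⟩ | ⟨hl1, hl2, A, G, hc, hi⟩
      · rcases hR with ⟨y, rfl, hy⟩ | ⟨hr1, hr2, A, G, hc, hi⟩
        · simp [isLeafB] at h
        · obtain ⟨A', G', hP, hI, hlt⟩ := plant_core r Y A G hc hi hr1 hr2 0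
          obtain ⟨z1, hz1, hz1'⟩ := hr1
          obtain ⟨z2, hz2, hz2'⟩ := hr2
          refine ⟨⟨z1, by simp [leafSet, hz1], hz1'⟩, ⟨z2, by simp [leafSet, hz2], hz2'⟩, _, _,
            core_join _ _ a b Y _ _ _ _ hd (plant_leaf x Y hx) hP,
            inj_join _ _ a b Y _ _ ?_ hI ?_⟩
          · intro u hu v hv _
            simp only [leafSet, Finset.mem_singleton, Finset.mem_inter, Finset.mem_coe] at hu hv
            rw [hu.1, hv.1]
          · intro u _ v hv
            exact (hlt v hv).ne
      · obtain ⟨A', G', hP, hI, hlt⟩ := plant_core l Y A G hc hi hl1 hl2 0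
        have hl1' := hl1
        obtain ⟨z1, hz1, hz1'⟩ := hl1
        obtain ⟨z2, hz2, hz2'⟩ := hl2
        refine ⟨⟨z1, by simp [leafSet, hz1], hz1'⟩, ⟨z2, by simp [leafSet, hz2], hz2'⟩, ?_⟩
        rcases hR with ⟨y, rfl, hy⟩ | ⟨hr1, hr2, B, H, hc', hi'⟩
        · refine ⟨_, _, core_join _ _ a b Y _ _ _ _ hd hP (plant_leaf y Y hy),
            inj_join _ _ a b Y _ _ hI ?_ ?_⟩
          · intro u hu v hv _
            simp only [leafSet, Finset.mem_singleton, Finset.mem_inter, Finset.mem_coe] at hu hv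
            rw [hu.1, hv.1]
          · intro u hu v hv
            exact (hlt u hu).ne'
        · obtain ⟨x0, -, hx0⟩ := Finset.exists_max_image (l.leafSet ∩ Y) G'
            ⟨z1, Finset.mem_inter.2 ⟨hz1, hz1'⟩⟩
          obtain ⟨B', H', hP', hI', hlt'⟩ := plant_core r Y B H hc' hi' hr1 hr2 (G' x0)
          refine ⟨_, _, core_join _ _ a b Y _ _ _ _ hd hP hP',
            inj_join _ _ a b Y _ _ hI hI' ?_⟩
          intro u hu v hv
          exact ((hx0 u hu).trans_lt (hlt' v hv)).ne

end PhyloTree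
end Phylo

theorem exists_lengths_reversible_one_leaf_per_cherry {α : Type} [DecidableEq α]
    (T : PhyloTree α) (hleaf : T.distinctLeaves) (hn : 2 ≤ T.numLeaves)
    (X' : Finset α) (hX' : T.oneLeafPerCherry X') :
    ∃ T' : PhyloTree α, T.sameShape T' ∧ T'.distinctLeaves ∧ T'.posLengths ∧
      T'.strict ∧ T'.reversible X' ∧
      (∃ xmax ∈ T'.leafSet, xmax ∉ X' ∧
        ∀ y ∈ T'.leafSet, y ≠ xmax → T'.FP y < T'.FP xmax) ∧
      (∃ xmin ∈ T'.leafSet, xmin ∈ X' ∧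
        ∀ y ∈ T'.leafSet, y ≠ xmin → T'.FP xmin < T'.FP y) := by
  have hY : ∀ x ∈ T.leafSet, (x ∈ T.leafSet \ X' ↔ x ∉ X') := by
    intro x hx; simp [hx]
  rcases exists_core (T.leafSet \ X') T hleaf
    (fun x hx hxY => hX'.1 x (by simpa [hx] using hxY))
    (fun p hp => by
      have := cherries_mem T p hp
      have h2 := hX'.2 p hp
      rw [hY _ this.1, hY _ this.2]
      tauto) with ⟨x, rfl, -⟩ | ⟨h1, h2, A, G, hc, hi⟩
  · simp [numLeaves, leafSet] at hn
  obtain ⟨x1, hx1, hx1'⟩ := h1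
  obtain ⟨x2, hx2, hx2'⟩ := h2
  rw [hY _ hx1] at hx1'
  rw [hY _ hx2, not_not] at hx2'
  obtain ⟨xC, -, hC⟩ := Finset.exists_max_image T.leafSet A ⟨x1, hx1⟩
  obtain ⟨xW, -, hW⟩ := Finset.exists_max_image T.leafSet G ⟨x1, hx1⟩
  obtain ⟨g, hg⟩ := Set.countable_iff_exists_injOn.1 (Finset.countable_toSet T.leafSet)
  obtain ⟨f, hf⟩ : ∃ f : α → ℝ, f = fun x => if x ∈ X' then A xC + 1 / ((g x : ℝ) + 2)
    else A xC + 1 + (G xW - G x) / 2 := ⟨_, rfl⟩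
  have hfd : ∀ x ∈ X', f x = A xC + 1 / ((g x : ℝ) + 2) := by
    intro x hx; simp [hf, hx]
  have hfr : ∀ x, x ∉ X' → f x = A xC + 1 + (G xW - G x) / 2 := by
    intro x hx; simp [hf, hx]
  have hfd1 : ∀ x ∈ X', A xC < f x ∧ f x < A xC + 1 := by
    intro x hx
    rw [hfd x hx]
    have h0 : (0:ℝ) ≤ g x := by positivity
    constructor
    · have : 0 < 1 / ((g x : ℝ) + 2) := by positivity
      linarith
    · have : 1 / ((g x : ℝ) + 2) < 1 := by
        rw [div_lt_one (by positivity)]; linarith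
      linarith
  have hfr1 : ∀ x ∈ T.leafSet, x ∉ X' → A xC + 1 ≤ f x := by
    intro x hx hx'
    rw [hfr x hx']
    have := hW x hx
    linarith
  have hinj : Set.InjOn f ↑T.leafSet := by
    intro x hx y hy hxy
    by_cases h1 : x ∈ X' <;> by_cases h2 : y ∈ X'
    · rw [hfd x h1, hfd y h2] at hxy
      apply hg hx hy
      have h3 := add_left_cancel hxy
      rw [one_div, one_div, inv_inj] at h3
      exact_mod_cast add_right_cancel h3
    · have := hfd1 x h1; have := hfr1 y hy h2; linarith
    · have := hfd1 y h2; have := hfr1 x hx h1; linarith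
    · rw [hfr x h1, hfr y h2] at hxy
      refine hi ?_ ?_ (by linarith)
      · simpa [h1] using hx
      · simpa [h2] using hy
  obtain ⟨T', hs, hp, hFP, e, t, hr, ht, hft⟩ := hc (fun x => f x - A x) (by
    intro x hx
    have h0 := hC x hx
    by_cases h : x ∈ X'
    · have := hfd1 x h; linarith
    · have := hfr1 x hx h; linarith)
  have hls := sameShape_leafSet _ _ hs
  have hFP' : ∀ x ∈ T.leafSet, T'.FP x = f x := by
    intro x hx; rw [hFP x hx]; ring
  refine ⟨T', hs, sameShape_distinct _ _ hs hleaf, hp, ?_, ?_, ?_, ?_⟩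
  · intro x hx y hy hxy
    rw [hls] at hx hy
    rw [hFP' x hx, hFP' y hy] at hxy
    exact hinj hx hy hxy
  · intro x hx y hy
    rw [hls] at hx hy ⊢
    have hx0 := Finset.mem_sdiff.1 hx
    have hy0 := Finset.mem_sdiff.1 hy
    have hrt : T'.restrictTree (T.leafSet \ X') = t := by simp [restrictTree, hr]
    rw [hrt, hFP' x hx0.1, hFP' y hy0.1]
    have e1 := hft x (Finset.mem_inter.2 ⟨hx0.1, hx⟩)
    have e2 := hft y (Finset.mem_inter.2 ⟨hy0.1, hy⟩)
    simp only [hfr x hx0.2, hfr y hy0.2] at e1 e2 ⊢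
    constructor <;> intro h <;> linarith
  · obtain ⟨m, hm, hmm⟩ := Finset.exists_max_image T.leafSet f ⟨x1, hx1⟩
    refine ⟨m, hls ▸ hm, ?_, ?_⟩
    · intro h
      have := hmm x1 hx1; have := hfd1 m h; have := hfr1 x1 hx1 hx1'
      linarith
    · intro y hy hym
      rw [hls] at hy
      rw [hFP' y hy, hFP' m hm]
      exact lt_of_le_of_ne (hmm y hy) (fun h => hym (hinj hy hm h))
  · obtain ⟨m, hm, hmm⟩ := Finset.exists_min_image T.leafSet f ⟨x1, hx1⟩
    refine ⟨m, hls ▸ hm, ?_, ?_⟩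
    · by_contra h
      have := hmm x2 hx2; have := hfd1 x2 hx2'; have := hfr1 m hm h
      linarith
    · intro y hy hym
      rw [hls] at hy
      rw [hFP' y hy, hFP' m hm]
      exact lt_of_le_of_ne (hmm y hy) (fun h => hym (hinj hm hy h).symm)
end

section
/- For every n ≥ 2 there exists a rooted binary phylogenetic X-tree T with |X| = n, namely the caterpillar tree, together with strictly positive edge lengths for T, such that the ranking induced by FP_T is strict and reversible with respect to X̃ := X∖{x}, where x = argmin_{x' ∈ X} FP_T(x') is the unique leaf with the lowest FP_T value. -/
open scoped Classical

open Phylo PhyloTree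

noncomputable def catC : ℕ → ℝ
  | 0 => 1
  | k + 1 => catC k + (k + 1)

noncomputable def catT : ℕ → PhyloTree ℕ
  | 0 => .node (.leaf 0) (.leaf 1) 1 (3 / 2)
  | k + 1 => .node (catT k) (.leaf (k + 2)) (((k : ℝ) + 2) * (k + 1))
      (catC (k + 1) + ((k : ℝ) + 2) / 2)

theorem catC_pos (k : ℕ) : 0 < catC k := by
  induction k with
  | zero => simp [catC]
  | succ k ih => simp only [catC]; positivity

theorem catT_leafSet (k : ℕ) : (catT k).leafSet = Finset.range (k + 2) := by
  induction k with
  | zero => ext x; simp [catT, leafSet]; omega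
  | succ k ih => ext x; simp [catT, leafSet, ih]; omega

theorem catT_numLeaves (k : ℕ) : (catT k).numLeaves = k + 2 := by
  simp [numLeaves, catT_leafSet]

theorem catT_distinct (k : ℕ) : (catT k).distinctLeaves := by
  induction k with
  | zero => simp [catT, distinctLeaves, leafSet]
  | succ k ih => simp [catT, distinctLeaves, ih, catT_leafSet]; simp [leafSet]

theorem catT_pos (k : ℕ) : (catT k).posLengths := by
  induction k with
  | zero => simp [catT, posLengths]
  | succ k ih =>
    have := catC_pos (k + 1)
    simp only [catT, posLengths, ih, and_true]
    constructor <;> positivity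

theorem catT_cherries (k : ℕ) : (catT k).cherries.card = 1 := by
  induction k with
  | zero => simp [catT, cherries]
  | succ k ih =>
    have : (catT (k + 1)).cherries = (catT k).cherries := by
      cases k <;> simp [catT, cherries]
    rw [this, ih]

theorem catT_FP (k : ℕ) : ∀ j, j < k + 2 → (catT k).FP j = catC k + (j : ℝ) / 2 := by
  induction k with
  | zero =>
    intro j hj
    have : j = 0 ∨ j = 1 := by omega
    rcases this with rfl | rfl <;> norm_num [catT, FP, leafSet, numLeaves, catC]
  | succ k ih =>
    intro j hj
    simp only [catT, FP, catT_leafSet, Finset.mem_range, catT_numLeaves]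
    split_ifs with h1 h2
    · rw [ih j h1]
      simp only [catC]
      have : (k : ℝ) + 2 ≠ 0 := by positivity
      push_cast
      field_simp
      ring
    · have : j = k + 2 := by simpa [leafSet] using h2
      subst this
      simp [numLeaves, leafSet]
    · exact absurd (show j = k + 2 by omega) (by simpa [leafSet] using h2)

theorem catT_restrict (k : ℕ) (Y : Finset ℕ) (h0 : 0 ∉ Y) :
    (∀ j, 1 ≤ j → j < k + 2 → j ∈ Y) →
    ∃ e t, (catT k).restrict? Y = some (e, t) ∧ t.leafSet = Finset.Icc 1 (k + 1) ∧
      ∀ j, 1 ≤ j → j < k + 2 →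
        t.FP j + e / ((k : ℝ) + 1) = catC k + ((k : ℝ) + 1) - (j : ℝ) / 2 := by
  induction k with
  | zero =>
    intro hY
    refine ⟨3 / 2, .leaf 1, ?_, ?_, ?_⟩
    · simp [catT, restrict?, h0, hY 1 (by norm_num) (by norm_num)]
    · simp [leafSet]
    · intro j h1 h2
      obtain rfl : j = 1 := by omega
      norm_num [FP, catC]
  | succ k ih =>
    intro hY
    obtain ⟨e, t, h1, h2, h3⟩ := ih (fun j a b => hY j a (by omega))
    refine ⟨0, .node t (.leaf (k + 2)) (((k : ℝ) + 2) * (k + 1) + e)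
      (catC (k + 1) + ((k : ℝ) + 2) / 2 + 0), ?_, ?_, ?_⟩
    · simp [catT, restrict?, h1, hY (k + 2) (by omega) (by omega)]
    · ext x; simp [leafSet, h2]; omega
    · intro j a b
      have hn : t.numLeaves = k + 1 := by simp [numLeaves, h2]
      simp only [FP, h2, Finset.mem_Icc, hn]
      have hk : (k : ℝ) + 1 ≠ 0 := by positivity
      split_ifs with g1 g2
      · have := h3 j a (by omega)
        simp only [catC]
        push_cast
        rw [add_div, mul_div_assoc, div_self hk, zero_div]
        linarith
      · have : j = k + 2 := by simpa [leafSet] using g2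
        subst this
        simp [numLeaves, leafSet]
        ring
      · exact absurd (show j = k + 2 by omega) (by simpa [leafSet] using g2)

/-- For every `n ≥ 2` there is a rooted binary phylogenetic tree on `n` leaves,
namely a caterpillar tree (exactly one cherry), with strictly positive edge lengths, such that
the FP ranking is strict and reversible with respect to the deletion of the single leaf `x`
attaining the minimal FP value. -/
theorem exists_caterpillar_reversible_single_deletion (n : ℕ) (hn : 2 ≤ n) :
    ∃ T : PhyloTree ℕ, T.distinctLeaves ∧ T.posLengths ∧ T.numLeaves = n ∧
      T.cherries.card = 1 ∧ T.strict ∧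
      ∃ x ∈ T.leafSet,
        (∀ y ∈ T.leafSet, y ≠ x → T.FP x < T.FP y) ∧
        T.reversible {x} := by
  obtain ⟨k, rfl⟩ : ∃ k, n = k + 2 := ⟨n - 2, by omega⟩
  refine ⟨catT k, catT_distinct k, catT_pos k, catT_numLeaves k, catT_cherries k, ?_, 0, ?_, ?_, ?_⟩
  · intro x hx y hy h
    rw [catT_leafSet, Finset.mem_coe, Finset.mem_range] at hx hy
    rw [catT_FP k x hx, catT_FP k y hy] at h
    have : (x : ℝ) = y := by linarith
    exact_mod_cast this
  · simp [catT_leafSet]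
  · intro y hy hne
    rw [catT_leafSet, Finset.mem_range] at hy
    rw [catT_FP k 0 (by omega), catT_FP k y hy]
    have : (0 : ℝ) < y := by exact_mod_cast Nat.pos_of_ne_zero hne
    push_cast
    linarith
  · intro x hx y hy
    obtain ⟨e, t, h1, -, h3⟩ := catT_restrict k ((catT k).leafSet \ {0}) (by simp)
      (by intro j a b; simp [catT_leafSet]; omega)
    have ht : (catT k).restrictTree ((catT k).leafSet \ {0}) = t := by
      simp [restrictTree, h1]
    rw [ht]
    simp only [catT_leafSet, Finset.mem_sdiff, Finset.mem_range, Finset.mem_singleton] at hx hy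
    have hx' := h3 x (by omega) hx.1
    have hy' := h3 y (by omega) hy.1
    rw [catT_FP k x hx.1, catT_FP k y hy.1]
    constructor <;> intro h <;> linarith
end

section
/- Let T be a rooted binary phylogenetic X-tree with |X| = n ≥ 2. Then there exist strictly positive edge lengths λ_1, …, λ_{2n−2} for T such that (i) the ranking induced by FP_T is strict, and (ii) if y := argmin_{x ∈ X} FP_T(x) is deleted from T to give the induced subtree T̃ = T_{X∖{y}} on X̃ = X∖{y}, then the ranking induced by FP_{T̃} is strict and argmax_{x ∈ X̃} FP_{T̃}(x) = argmin_{x ∈ X̃} FP_T(x); that is, if the species with the lowest FP_T value goes extinct, the species with the second lowest FP_T value has the highest FP_{T̃} value. -/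
open scoped Classical

open Phylo PhyloTree

namespace Phylo
namespace PhyloTree

theorem sameShape_leafSet_s4 {α : Type} [DecidableEq α] :
    ∀ (S T : PhyloTree α), S.sameShape T → T.leafSet = S.leafSet
  | leaf x, leaf y, h => by simp only [sameShape] at h; subst h; rfl
  | leaf x, node _ _ _ _, h => by simp [sameShape] at h
  | node _ _ _ _, leaf y, h => by simp [sameShape] at h
  | node l r _ _, node l' r' _ _, h => by
    simp only [sameShape] at h
    simp only [leafSet, sameShape_leafSet_s4 l l' h.1, sameShape_leafSet_s4 r r' h.2]

theorem sameShape_distinct_s4 {α : Type} [DecidableEq α] :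
    ∀ (S T : PhyloTree α), S.sameShape T → S.distinctLeaves → T.distinctLeaves
  | leaf x, leaf y, h => by simp [distinctLeaves]
  | leaf x, node _ _ _ _, h => by simp [sameShape] at h
  | node _ _ _ _, leaf y, h => by simp [sameShape] at h
  | node l r _ _, node l' r' _ _, h => by
    simp only [sameShape] at h
    intro hd
    simp only [distinctLeaves] at hd ⊢
    rw [sameShape_leafSet_s4 l l' h.1, sameShape_leafSet_s4 r r' h.2]
    exact ⟨hd.1, sameShape_distinct_s4 l l' h.1 hd.2.1, sameShape_distinct_s4 r r' h.2 hd.2.2⟩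

theorem leafSet_nonempty {α : Type} [DecidableEq α] (S : PhyloTree α) : S.leafSet.Nonempty := by
  induction S with
  | leaf x => simp [leafSet]
  | node l r a b ihl ihr => simp only [leafSet]; exact ihl.mono Finset.subset_union_left

theorem numLeaves_pos {α : Type} [DecidableEq α] (S : PhyloTree α) : 0 < S.numLeaves :=
  Finset.card_pos.2 S.leafSet_nonempty

theorem restrict_congr {α : Type} [DecidableEq α] (S : PhyloTree α) (Y Z : Finset α)
    (h : ∀ x ∈ S.leafSet, (x ∈ Y ↔ x ∈ Z)) : S.restrict? Y = S.restrict? Z := by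
  induction S with
  | leaf x => simp only [restrict?, h x (by simp [leafSet])]
  | node l r a b ihl ihr =>
    simp only [leafSet, Finset.mem_union] at h
    simp only [restrict?, ihl (fun x hx => h x (Or.inl hx)), ihr (fun x hx => h x (Or.inr hx))]

theorem restrict_full {α : Type} [DecidableEq α] (S : PhyloTree α) (Y : Finset α)
    (h : ∀ x ∈ S.leafSet, x ∈ Y) : S.restrict? Y = some (0, S) := by
  induction S with
  | leaf x => simp [restrict?, h x (by simp [leafSet])]
  | node l r a b ihl ihr =>
    simp only [leafSet, Finset.mem_union] at h
    simp [restrict?, ihl (fun x hx => h x (Or.inl hx)), ihr (fun x hx => h x (Or.inr hx))]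

theorem FP_left {α : Type} [DecidableEq α] (l r : PhyloTree α) (a b : ℝ) (x : α)
    (h : x ∈ l.leafSet) : (node l r a b).FP x = l.FP x + a / (l.numLeaves : ℝ) := by
  simp [FP, h]

theorem FP_right {α : Type} [DecidableEq α] (l r : PhyloTree α) (a b : ℝ) (x : α)
    (hd : x ∉ l.leafSet) (h : x ∈ r.leafSet) :
    (node l r a b).FP x = r.FP x + b / (r.numLeaves : ℝ) := by
  simp [FP, h, hd]

theorem exists_fill {α : Type} [DecidableEq α] (S : PhyloTree α) (hS : S.distinctLeaves) :
    ∀ (s t : ℝ) (F : Finset ℝ), 0 ≤ s → s < t →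
    ∃ (S' : PhyloTree α) (b : ℝ), S.sameShape S' ∧ S'.posLengths ∧ 0 < b ∧
      Set.InjOn (fun x => S'.FP x + b / (S'.numLeaves : ℝ)) S'.leafSet ∧
      ∀ x ∈ S'.leafSet, s < S'.FP x + b / (S'.numLeaves : ℝ) ∧
        S'.FP x + b / (S'.numLeaves : ℝ) < t ∧ S'.FP x + b / (S'.numLeaves : ℝ) ∉ F := by
  induction S with
  | leaf x =>
    intro s t F hs hst
    obtain ⟨b, hb, hbF⟩ := (Set.Ioo_infinite hst).exists_notMem_finset F
    refine ⟨leaf x, b, rfl, trivial, hs.trans_lt hb.1, ?_, ?_⟩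
    · simp [leafSet]
    · intro z _
      simpa [FP, numLeaves, leafSet] using ⟨hb.1, hb.2, hbF⟩
  | node l r a b ihl ihr =>
    intro s t F hs hst
    obtain ⟨hd, hdl, hdr⟩ := hS
    obtain ⟨c, hc⟩ : ∃ c, c = (t - s) / 2 := ⟨_, rfl⟩
    have hc0 : 0 < c := by linarith
    obtain ⟨l', bl, hl1, hl2, hl3, hl4, hl5⟩ :=
      ihl hdl s (s + c) (F.image (fun v => v - c)) hs (by linarith)
    obtain ⟨r', br, hr1, hr2, hr3, hr4, hr5⟩ :=
      ihr hdr s (s + c) (F.image (fun v => v - c) ∪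
        l'.leafSet.image (fun x => l'.FP x + bl / (l'.numLeaves : ℝ))) hs (by linarith)
    have hd' : Disjoint l'.leafSet r'.leafSet := by
      rwa [sameShape_leafSet_s4 _ _ hl1, sameShape_leafSet_s4 _ _ hr1]
    have hN : (0 : ℝ) < (node l' r' bl br).numLeaves := by exact_mod_cast numLeaves_pos _
    have hcN : c * ((node l' r' bl br).numLeaves : ℝ) / ((node l' r' bl br).numLeaves : ℝ) = c := by
      field_simp
    have hR : ∀ x ∈ r'.leafSet, (node l' r' bl br).FP x = r'.FP x + br / (r'.numLeaves : ℝ) :=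
      fun x hx => FP_right _ _ _ _ _ (Finset.disjoint_right.1 hd' hx) hx
    refine ⟨node l' r' bl br, c * (node l' r' bl br).numLeaves, ⟨hl1, hr1⟩,
      ⟨hl3, hr3, hl2, hr2⟩, by positivity, ?_, ?_⟩
    · rw [hcN]
      intro x hx z hz hxz
      simp only [leafSet, Finset.coe_union, Set.mem_union, Finset.mem_coe, add_left_inj] at hx hz hxz
      rcases hx with hx | hx <;> rcases hz with hz | hz
      · rw [FP_left _ _ _ _ _ hx, FP_left _ _ _ _ _ hz] at hxz
        exact hl4 hx hz hxz
      · rw [FP_left _ _ _ _ _ hx, hR _ hz] at hxz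
        exact absurd (Finset.mem_union_right _ (Finset.mem_image.2 ⟨x, hx, hxz⟩)) (hr5 z hz).2.2
      · rw [FP_left _ _ _ _ _ hz, hR _ hx] at hxz
        exact absurd (Finset.mem_union_right _ (Finset.mem_image.2 ⟨z, hz, hxz.symm⟩)) (hr5 x hx).2.2
      · rw [hR _ hx, hR _ hz] at hxz
        exact hr4 hx hz hxz
    · rw [hcN]
      intro x hx
      simp only [leafSet, Finset.mem_union] at hx
      rcases hx with hx | hx
      · rw [FP_left _ _ _ _ _ hx]
        obtain ⟨h1, h2, h3⟩ := hl5 x hx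
        exact ⟨by linarith, by linarith, fun h => h3 (Finset.mem_image.2 ⟨_, h, by ring⟩)⟩
      · rw [hR _ hx]
        obtain ⟨h1, h2, h3⟩ := hr5 x hx
        exact ⟨by linarith, by linarith,
          fun h => h3 (Finset.mem_union_left _ (Finset.mem_image.2 ⟨_, h, by ring⟩))⟩

structure Core {α : Type} (A : Finset α) (y w : α) (g0 g1 : α → ℝ) : Prop where
  hy : y ∈ A
  hw : w ∈ A
  hne : w ≠ y
  inj0 : ∀ x ∈ A, ∀ z ∈ A, g0 x = g0 z → x = z
  min0 : ∀ z ∈ A, z ≠ y → g0 y < g0 z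
  min1 : ∀ z ∈ A, z ≠ y → z ≠ w → g0 w < g0 z
  inj1 : ∀ x ∈ A, ∀ z ∈ A, x ≠ y → z ≠ y → g1 x = g1 z → x = z
  max1 : ∀ z ∈ A, z ≠ y → z ≠ w → g1 z < g1 w
  hlt : g0 w < g1 w

theorem Core.extend {α : Type} [DecidableEq α] {A B C : Finset α} {y w : α} {g0 g1 h G0 G1 : α → ℝ}
    {c0 c1 : ℝ} (H : Core A y w g0 g1) (hC : ∀ x, x ∈ C ↔ x ∈ A ∨ x ∈ B)
    (hinj : ∀ x ∈ B, ∀ z ∈ B, h x = h z → x = z)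
    (hB : ∀ x ∈ B, x ∉ A ∧ g0 w < h x ∧ h x < g1 w ∧ ∀ z ∈ A, h x ≠ g0 z ∧ h x ≠ g1 z)
    (hc : c0 ≤ c1)
    (h0A : ∀ x ∈ A, G0 x = g0 x + c0) (h0B : ∀ x ∈ B, G0 x = h x + c0)
    (h1A : ∀ x ∈ A, x ≠ y → G1 x = g1 x + c1) (h1B : ∀ x ∈ B, G1 x = h x + c1) :
    Core C y w G0 G1 := by
  obtain ⟨hy, hw, hne, i0, m0, m1, i1, M1, hl⟩ := H
  have hyw := m0 w hw hne
  have e0y := h0A y hy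
  have e0w := h0A w hw
  have e1w := h1A w hw hne
  refine ⟨(hC _).2 (Or.inl hy), (hC _).2 (Or.inl hw), hne, ?_, ?_, ?_, ?_, ?_, by linarith⟩
  · intro x hx z hz hxz
    rcases (hC _).1 hx with hx | hx <;> rcases (hC _).1 hz with hz | hz
    · exact i0 x hx z hz (by linarith [h0A x hx, h0A z hz])
    · exact absurd (by linarith [h0A x hx, h0B z hz]) ((hB z hz).2.2.2 x hx).1
    · exact absurd (by linarith [h0A z hz, h0B x hx]) ((hB x hx).2.2.2 z hz).1
    · exact hinj x hx z hz (by linarith [h0B x hx, h0B z hz])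
  · intro z hz hzy
    rcases (hC _).1 hz with hz | hz
    · linarith [h0A z hz, m0 z hz hzy]
    · linarith [h0B z hz, (hB z hz).2.1]
  · intro z hz hzy hzw
    rcases (hC _).1 hz with hz | hz
    · linarith [h0A z hz, m1 z hz hzy hzw]
    · linarith [h0B z hz, (hB z hz).2.1]
  · intro x hx z hz hxy hzy hxz
    rcases (hC _).1 hx with hx | hx <;> rcases (hC _).1 hz with hz | hz
    · exact i1 x hx z hz hxy hzy (by linarith [h1A x hx hxy, h1A z hz hzy])
    · exact absurd (by linarith [h1A x hx hxy, h1B z hz]) ((hB z hz).2.2.2 x hx).2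
    · exact absurd (by linarith [h1A z hz hzy, h1B x hx]) ((hB x hx).2.2.2 z hz).2
    · exact hinj x hx z hz (by linarith [h1B x hx, h1B z hz])
  · intro z hz hzy hzw
    rcases (hC _).1 hz with hz | hz
    · linarith [h1A z hz hzy, M1 z hz hzy hzw]
    · linarith [h1B z hz, (hB z hz).2.2.1]

def Good {α : Type} [DecidableEq α] (S : PhyloTree α) : Prop :=
  ∃ (S' : PhyloTree α) (a : ℝ) (y w : α) (e : ℝ) (t : PhyloTree α),
    S.sameShape S' ∧ S'.posLengths ∧ 0 < a ∧
    S'.restrict? (S'.leafSet \ {y}) = some (e, t) ∧ t.leafSet = S'.leafSet \ {y} ∧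
    (∀ x ∈ S'.leafSet, 0 ≤ S'.FP x) ∧
    Core S'.leafSet y w (fun x => S'.FP x + a / (S'.numLeaves : ℝ))
      (fun x => t.FP x + (a + e) / (t.numLeaves : ℝ))

theorem FP_nonneg {α : Type} [DecidableEq α] (S : PhyloTree α) (h : S.posLengths) (x : α) :
    0 ≤ S.FP x := by
  induction S with
  | leaf x => simp [FP]
  | node l r a b ihl ihr =>
    obtain ⟨h1, h2, h3, h4⟩ := h
    have := ihl h3
    have := ihr h4
    simp only [FP]
    split_ifs <;> positivity

theorem good_node {α : Type} [DecidableEq α] (l r : PhyloTree α) (a₀ b₀ : ℝ)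
    (hd : Disjoint l.leafSet r.leafSet) (hr : r.distinctLeaves) (hg : Good l) :
    Good (node l r a₀ b₀) ∧ Good (node r l b₀ a₀) := by
  obtain ⟨l', a, y, w, e, t, h1, h2, h3, h4, h5, h6, H⟩ := hg
  obtain ⟨r', b, k1, k2, k3, k4, k5⟩ := exists_fill r hr (l'.FP w + a / (l'.numLeaves : ℝ))
    (t.FP w + (a + e) / (t.numLeaves : ℝ))
    (l'.leafSet.image (fun x => l'.FP x + a / (l'.numLeaves : ℝ)) ∪
      l'.leafSet.image (fun x => t.FP x + (a + e) / (t.numLeaves : ℝ)))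
    (by have := h6 w H.hw; positivity) H.hlt
  have hd' : Disjoint l'.leafSet r'.leafSet := by
    rwa [sameShape_leafSet_s4 _ _ h1, sameShape_leafSet_s4 _ _ k1]
  have hnl : ∀ x ∈ r'.leafSet, x ∉ l'.leafSet := fun x hx => Finset.disjoint_right.1 hd' hx
  have hnr : ∀ x ∈ l'.leafSet, x ∉ r'.leafSet := fun x hx => Finset.disjoint_left.1 hd' hx
  have hyr := hnr y H.hy
  have hrl : l'.restrict? ((l'.leafSet ∪ r'.leafSet) \ {y}) = some (e, t) := by
    rw [← h4]
    apply restrict_congr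
    intro x hx
    simp [hx]
  have hrr : r'.restrict? ((l'.leafSet ∪ r'.leafSet) \ {y}) = some (0, r') := by
    apply restrict_full
    intro x hx
    simp only [Finset.mem_sdiff, Finset.mem_union, Finset.mem_singleton]
    exact ⟨Or.inr hx, fun h => hyr (h ▸ hx)⟩
  have htl : ∀ x, x ∈ t.leafSet ↔ x ∈ l'.leafSet ∧ x ≠ y := by
    intro x; rw [h5]; simp
  have hB : ∀ x ∈ r'.leafSet, x ∉ l'.leafSet ∧
      (fun x => l'.FP x + a / (l'.numLeaves : ℝ)) w < (fun x => r'.FP x + b / (r'.numLeaves : ℝ)) x ∧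
      (fun x => r'.FP x + b / (r'.numLeaves : ℝ)) x < (fun x => t.FP x + (a + e) / (t.numLeaves : ℝ)) w ∧
      ∀ z ∈ l'.leafSet, (fun x => r'.FP x + b / (r'.numLeaves : ℝ)) x ≠
          (fun x => l'.FP x + a / (l'.numLeaves : ℝ)) z ∧
        (fun x => r'.FP x + b / (r'.numLeaves : ℝ)) x ≠
          (fun x => t.FP x + (a + e) / (t.numLeaves : ℝ)) z := by
    intro x hx
    obtain ⟨q1, q2, q3⟩ := k5 x hx
    refine ⟨hnl x hx, q1, q2, fun z hz => ⟨fun h => q3 ?_, fun h => q3 ?_⟩⟩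
    · exact Finset.mem_union_left _ (Finset.mem_image.2 ⟨z, hz, h.symm⟩)
    · exact Finset.mem_union_right _ (Finset.mem_image.2 ⟨z, hz, h.symm⟩)
  have hcc : ∀ U V : PhyloTree α, V.leafSet ⊆ U.leafSet →
      (1 : ℝ) / (U.numLeaves : ℝ) ≤ (1 + 0) / (V.numLeaves : ℝ) := by
    intro U V hUV
    rw [add_zero]
    apply one_div_le_one_div_of_le
    · exact_mod_cast numLeaves_pos V
    · exact_mod_cast Finset.card_le_card hUV
  constructor
  · have hls : (node t r' (a + e) (b + 0)).leafSet = (node l' r' a b).leafSet \ {y} := by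
      ext x
      simp only [leafSet, Finset.mem_sdiff, Finset.mem_union, Finset.mem_singleton, htl]
      constructor
      · rintro (h | h)
        · exact ⟨Or.inl h.1, h.2⟩
        · exact ⟨Or.inr h, fun h' => hyr (h' ▸ h)⟩
      · tauto
    have hpos : (node l' r' a b).posLengths := ⟨h3, k3, h2, k2⟩
    refine ⟨node l' r' a b, 1, y, w, 0, node t r' (a + e) (b + 0), ⟨h1, k1⟩, hpos, one_pos,
      ?_, hls, fun x _ => FP_nonneg _ hpos x, ?_⟩
    · simp only [leafSet, restrict?, hrl, hrr]
    · refine H.extend (B := r'.leafSet) (fun x => by simp [leafSet]) k4 hB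
        (hcc (node l' r' a b) (node t r' (a + e) (b + 0)) (by rw [hls]; exact Finset.sdiff_subset))
        ?_ ?_ ?_ ?_
      · intro x hx
        simp only [FP_left _ r' a b x hx]
      · intro x hx
        simp only [FP_right l' r' a b x (hnl x hx) hx]
      · intro x hx hxy
        simp only [FP_left t r' (a + e) (b + 0) x ((htl x).2 ⟨hx, hxy⟩)]
      · intro x hx
        simp only [FP_right t r' (a + e) b x (fun h => hnl x hx ((htl x).1 h).1) hx, add_zero]
  · have hls : (node r' t (b + 0) (a + e)).leafSet = (node r' l' b a).leafSet \ {y} := by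
      ext x
      simp only [leafSet, Finset.mem_sdiff, Finset.mem_union, Finset.mem_singleton, htl]
      constructor
      · rintro (h | h)
        · exact ⟨Or.inl h, fun h' => hyr (h' ▸ h)⟩
        · exact ⟨Or.inr h.1, h.2⟩
      · tauto
    have hpos : (node r' l' b a).posLengths := ⟨k3, h3, k2, h2⟩
    refine ⟨node r' l' b a, 1, y, w, 0, node r' t (b + 0) (a + e), ⟨k1, h1⟩, hpos, one_pos,
      ?_, hls, fun x _ => FP_nonneg _ hpos x, ?_⟩
    · rw [Finset.union_comm] at hrl hrr
      simp only [leafSet, restrict?, hrl, hrr]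
    · refine H.extend (B := r'.leafSet) (fun x => by simp [leafSet, or_comm]) k4 hB
        (hcc (node r' l' b a) (node r' t (b + 0) (a + e)) (by rw [hls]; exact Finset.sdiff_subset))
        ?_ ?_ ?_ ?_
      · intro x hx
        simp only [FP_right r' l' b a x (hnr x hx) hx]
      · intro x hx
        simp only [FP_left r' l' b a x hx]
      · intro x hx hxy
        simp only [FP_right r' t (b + 0) (a + e) x (hnr x hx) ((htl x).2 ⟨hx, hxy⟩)]
      · intro x hx
        simp only [FP_left r' t b (a + e) x hx, add_zero]

theorem good_cherry {α : Type} [DecidableEq α] (w y : α) (h : w ≠ y) (a b : ℝ) :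
    Good (node (leaf w) (leaf y) a b) := by
  have hc : (({w} : Finset α) ∪ {y}).card = 2 := by
    rw [Finset.card_union_of_disjoint (by simpa using h)]; simp
  have hF1 : (node (leaf w) (leaf y) (2 : ℝ) 1).FP w = 2 := by
    simp [FP, leafSet, numLeaves]
  have hF2 : (node (leaf w) (leaf y) (2 : ℝ) 1).FP y = 1 := by
    simp [FP, leafSet, numLeaves, h.symm]
  have hpos : (node (leaf w) (leaf y) (2 : ℝ) 1).posLengths := by
    simp [posLengths]
  refine ⟨node (leaf w) (leaf y) 2 1, 2, y, w, 2 + 0, leaf w, ⟨rfl, rfl⟩, hpos, two_pos, ?_, ?_,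
    fun x _ => FP_nonneg _ hpos x, ?_⟩
  · simp [restrict?, leafSet, h, h.symm]
  · ext x
    simp only [leafSet, Finset.mem_sdiff, Finset.mem_union, Finset.mem_singleton]
    constructor
    · rintro rfl; exact ⟨Or.inl rfl, h⟩
    · tauto
  · have hm : ∀ x, x ∈ (node (leaf w) (leaf y) (2 : ℝ) 1).leafSet ↔ x = w ∨ x = y := by
      simp [leafSet]
    have hn : (node (leaf w) (leaf y) (2 : ℝ) 1).numLeaves = 2 := hc
    refine ⟨(hm _).2 (Or.inr rfl), (hm _).2 (Or.inl rfl), h, ?_, ?_, ?_, ?_, ?_, ?_⟩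
    · intro x hx z hz hxz
      rcases (hm x).1 hx with rfl | rfl <;> rcases (hm z).1 hz with rfl | rfl
      · rfl
      · simp only [hF1, hF2] at hxz; norm_num at hxz
      · simp only [hF1, hF2] at hxz; norm_num at hxz
      · rfl
    · intro z hz hzy
      rcases (hm z).1 hz with rfl | rfl
      · simp only [hF1, hF2]; norm_num
      · exact absurd rfl hzy
    · intro z hz h1 h2
      have := (hm z).1 hz
      tauto
    · intro x hx z hz h1 h2 _
      have := (hm z).1 hz
      have := (hm x).1 hx
      simp_all
    · intro z hz h1 h2
      have := (hm z).1 hz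
      tauto
    · simp only [hF1, hn]
      simp [FP, numLeaves, leafSet]

theorem good_all {α : Type} [DecidableEq α] (S : PhyloTree α) (hS : S.distinctLeaves)
    (hn : 2 ≤ S.numLeaves) : Good S := by
  induction S with
  | leaf x => simp [numLeaves, leafSet] at hn
  | node l r a b ihl ihr =>
    obtain ⟨hd, hl, hr⟩ := hS
    by_cases h2 : 2 ≤ l.numLeaves
    · exact (good_node l r a b hd hr (ihl hl h2)).1
    by_cases h3 : 2 ≤ r.numLeaves
    · exact (good_node r l b a hd.symm hl (ihr hr h3)).2
    have key : ∀ S : PhyloTree α, S.distinctLeaves → ¬ 2 ≤ S.numLeaves → ∃ x, S = leaf x := by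
      intro S hS h
      cases S with
      | leaf x => exact ⟨x, rfl⟩
      | node l r a b =>
        exfalso
        have h1 := numLeaves_pos l
        have h2 := numLeaves_pos r
        have := Finset.card_union_of_disjoint hS.1
        simp only [numLeaves, leafSet] at h h1 h2
        omega
    obtain ⟨x, rfl⟩ := key l hl h2
    obtain ⟨z, rfl⟩ := key r hr h3
    exact good_cherry x z (by simpa [leafSet] using hd) a b

end PhyloTree
end Phylo

/-- Every tree shape admits strictly positive edge lengths such that the FP
ranking is strict and, when the leaf `y` of minimal FP value is deleted, the induced subtree
has a strict FP ranking in which the leaf `w` of second lowest original FP value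
(i.e. minimal among the remaining leaves) attains the highest FP value. -/
theorem exists_lengths_second_lowest_becomes_highest {α : Type} [DecidableEq α]
    (T : PhyloTree α) (hleaf : T.distinctLeaves) (hn : 2 ≤ T.numLeaves) :
    ∃ T' : PhyloTree α, T.sameShape T' ∧ T'.distinctLeaves ∧ T'.posLengths ∧
      T'.strict ∧
      ∃ y ∈ T'.leafSet,
        (∀ z ∈ T'.leafSet, z ≠ y → T'.FP y < T'.FP z) ∧
        (T'.restrictTree (T'.leafSet \ {y})).strict ∧
        ∃ w ∈ T'.leafSet \ {y},
          (∀ z ∈ T'.leafSet \ {y}, z ≠ w → T'.FP w < T'.FP z) ∧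
          (∀ z ∈ T'.leafSet \ {y}, z ≠ w →
            (T'.restrictTree (T'.leafSet \ {y})).FP z <
              (T'.restrictTree (T'.leafSet \ {y})).FP w) := by
  obtain ⟨T', a, y, w, e, t, h1, h2, h3, h4, h5, h6, H⟩ := good_all T hleaf hn
  have ht : T'.restrictTree (T'.leafSet \ {y}) = t := by simp only [restrictTree, h4]
  obtain ⟨hy, hw, hne, i0, m0, m1, i1, M1, hl⟩ := H
  simp only [add_left_inj, add_lt_add_iff_right] at i0 m0 m1 i1 M1
  refine ⟨T', h1, sameShape_distinct_s4 _ _ h1 hleaf, h2, fun x hx z hz => i0 x hx z hz, y, hy, m0,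
    ?_, w, by simp [hw, hne], ?_, ?_⟩
  · rw [ht]
    intro x hx z hz
    rw [Finset.mem_coe, h5, Finset.mem_sdiff, Finset.mem_singleton] at hx hz
    exact i1 x hx.1 z hz.1 hx.2 hz.2
  · intro z hz
    rw [Finset.mem_sdiff, Finset.mem_singleton] at hz
    exact m1 z hz.1 hz.2
  · rw [ht]
    intro z hz
    rw [Finset.mem_sdiff, Finset.mem_singleton] at hz
    exact M1 z hz.1 hz.2
end

section
/- Let T = (T_a, T_b) be a rooted binary phylogenetic X-tree with |X| = n ≥ 3, where T_a and T_b have n_a and n_b leaves respectively with n_a ≥ n_b, and let f assign strictly positive lengths to all edges of T. Let x* := argmax_{x ∈ X} FP_T(x). If a leaf x' ≠ x* is deleted to derive the induced subtree T̃ = T_{X∖{x'}}, then the number 𝒩 of leaves with a higher FP_{T̃} value than x* in T̃ satisfies 𝒩 ≤ n_a − 1 (and ⌊(n−1)/2⌋ ≤ n_a − 1). -/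
open scoped Classical

open Phylo PhyloTree

theorem Phylo.aux_none {α : Type} [DecidableEq α] (Y : Finset α) (T : PhyloTree α)
    (h : T.restrict? Y = none) : ∀ y ∈ T.leafSet, y ∉ Y := by
  induction T with
  | leaf x => 
    simp only [restrict?] at h
    simp only [leafSet, Finset.mem_singleton]
    rintro y rfl hy
    simp [hy] at h
  | node l r a b ihl ihr =>
    simp only [restrict?] at h
    rcases hl : l.restrict? Y with _ | ⟨ea, l'⟩ <;> rcases hr : r.restrict? Y with _ | ⟨eb, r'⟩ <;>
      simp only [hl, hr] at h
    · simp only [leafSet, Finset.mem_union]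
      rintro y (hy | hy)
      · exact ihl hl y hy
      · exact ihr hr y hy
    all_goals cases h

theorem Phylo.aux_full {α : Type} [DecidableEq α] (Y : Finset α) (T : PhyloTree α)
    (h : ∀ y ∈ T.leafSet, y ∈ Y) : T.restrict? Y = some (0, T) := by
  induction T with
  | leaf x => simp [restrict?, h x (by simp [leafSet])]
  | node l r a b ihl ihr =>
    have hl := ihl (fun y hy => h y (by simp [leafSet, hy]))
    have hr := ihr (fun y hy => h y (by simp [leafSet, hy]))
    simp [restrict?, hl, hr]

theorem Phylo.aux_div {α : Type} [DecidableEq α] (Y : Finset α) (T T' : PhyloTree α) (a : ℝ)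
    (ha : 0 ≤ a) (h : ∀ y, y ∈ T'.leafSet ↔ y ∈ T.leafSet ∧ y ∈ Y) (y : α)
    (hy : y ∈ T'.leafSet) : a / (T.numLeaves : ℝ) ≤ a / (T'.numLeaves : ℝ) := by
  have h1 : 0 < T'.numLeaves := Finset.card_pos.mpr ⟨y, hy⟩
  have h2 : T'.numLeaves ≤ T.numLeaves := Finset.card_le_card (fun z hz => ((h z).1 hz).1)
  have h1' : (0 : ℝ) < T'.numLeaves := by exact_mod_cast h1
  have h2' : (T'.numLeaves : ℝ) ≤ T.numLeaves := by exact_mod_cast h2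
  exact div_le_div_of_nonneg_left ha h1' h2'

theorem Phylo.aux_some {α : Type} [DecidableEq α] (Y : Finset α) (T : PhyloTree α)
    (hp : T.posLengths) : ∀ (e : ℝ) (T' : PhyloTree α), T.restrict? Y = some (e, T') →
    0 ≤ e ∧ (∀ y, y ∈ T'.leafSet ↔ y ∈ T.leafSet ∧ y ∈ Y) ∧
    ∀ y ∈ T'.leafSet, T.FP y ≤ T'.FP y + e / (T'.numLeaves : ℝ) := by
  induction T with
  | leaf x =>
    intro e T' h
    simp only [restrict?] at h
    split_ifs at h with hx
    simp only [Option.some.injEq, Prod.mk.injEq] at h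
    obtain ⟨rfl, rfl⟩ := h
    refine ⟨le_rfl, ?_, ?_⟩
    · intro y
      simp only [leafSet, Finset.mem_singleton]
      constructor
      · rintro rfl
        exact ⟨rfl, hx⟩
      · exact fun h => h.1
    · intro y _
      simp [FP]
  | node l r a b ihl ihr =>
    obtain ⟨ha, hb, hpl, hpr⟩ := hp
    intro e T' h
    simp only [restrict?] at h
    rcases hl : l.restrict? Y with _ | ⟨ea, l'⟩ <;> rcases hr : r.restrict? Y with _ | ⟨eb, r'⟩ <;>
      simp only [hl, hr, Option.some.injEq, Prod.mk.injEq, reduceCtorEq] at h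
    · obtain ⟨rfl, rfl⟩ := h
      have hn := aux_none Y l hl
      obtain ⟨h0, h1, h2⟩ := ihr hpr _ _ hr
      refine ⟨by linarith, ?_, ?_⟩
      · intro y
        rw [h1]
        simp only [leafSet, Finset.mem_union]
        have := hn y
        tauto
      · intro y hy
        have hy' := (h1 y).1 hy
        have hyl : y ∉ l.leafSet := fun hh => hn y hh hy'.2
        have := aux_div Y r r' b hb.le h1 y hy
        have := h2 y hy
        simp only [FP, hyl, hy'.1, if_true, if_false, add_div]
        linarith
    · obtain ⟨rfl, rfl⟩ := h
      have hn := aux_none Y r hr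
      obtain ⟨h0, h1, h2⟩ := ihl hpl _ _ hl
      refine ⟨by linarith, ?_, ?_⟩
      · intro y
        rw [h1]
        simp only [leafSet, Finset.mem_union]
        have := hn y
        tauto
      · intro y hy
        have hy' := (h1 y).1 hy
        have := aux_div Y l l' a ha.le h1 y hy
        have := h2 y hy
        simp only [FP, hy'.1, if_true, add_div]
        linarith
    · obtain ⟨rfl, rfl⟩ := h
      obtain ⟨h0, h1, h2⟩ := ihl hpl _ _ hl
      obtain ⟨h0', h1', h2'⟩ := ihr hpr _ _ hr
      refine ⟨le_rfl, ?_, ?_⟩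
      · intro y
        simp only [leafSet, Finset.mem_union, h1, h1']
        tauto
      · intro y hy
        simp only [leafSet, Finset.mem_union] at hy
        by_cases hyl : y ∈ l'.leafSet
        · have hy' := (h1 y).1 hyl
          have := aux_div Y l l' a ha.le h1 y hyl
          have := h2 y hyl
          simp only [FP, hyl, hy'.1, if_true, add_div, zero_div]
          linarith
        · have hyr : y ∈ r'.leafSet := by tauto
          have hy' := (h1' y).1 hyr
          have hyl' : y ∉ l.leafSet := fun hh => hyl ((h1 y).2 ⟨hh, hy'.2⟩)
          have := aux_div Y r r' b hb.le h1' y hyr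
          have := h2' y hyr
          simp only [FP, hyl, hyl', hyr, hy'.1, if_true, if_false, add_div, zero_div]
          linarith

/-- In `T = (T_a, T_b)` with `n ≥ 3` leaves and `n_a ≥ n_b`, if a leaf
`x' ≠ x*` is deleted (where `x*` has maximal FP value in `T`), then the number of leaves
with a higher FP value than `x*` in the induced subtree is at most `n_a - 1`
(and `⌊(n-1)/2⌋ ≤ n_a - 1`). -/
theorem bound_on_leaves_overtaking_max {α : Type} [DecidableEq α]
    (Ta Tb : PhyloTree α) (la lb : ℝ) (T : PhyloTree α)
    (hT : T = PhyloTree.node Ta Tb la lb)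
    (hleaf : T.distinctLeaves) (hpos : T.posLengths)
    (hn : 3 ≤ T.numLeaves) (hab : Tb.numLeaves ≤ Ta.numLeaves)
    (xstar : α) (hxs : xstar ∈ T.leafSet)
    (hmax : ∀ y ∈ T.leafSet, T.FP y ≤ T.FP xstar)
    (x' : α) (hx' : x' ∈ T.leafSet) (hne : x' ≠ xstar) :
    ((T.leafSet \ {x'}).filter
        (fun z => (T.restrictTree (T.leafSet \ {x'})).FP xstar <
                  (T.restrictTree (T.leafSet \ {x'})).FP z)).card ≤ Ta.numLeaves - 1 ∧
    (T.numLeaves - 1) / 2 ≤ Ta.numLeaves - 1 := by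
  subst hT
  obtain ⟨hdisj, -, -⟩ := hleaf
  have hcard : (PhyloTree.node Ta Tb la lb).numLeaves = Ta.numLeaves + Tb.numLeaves :=
    Finset.card_union_of_disjoint hdisj
  refine ⟨?_, by omega⟩
  have hD : ∀ y ∈ Ta.leafSet, y ∉ Tb.leafSet := fun y h1 h2 => Finset.disjoint_left.1 hdisj h1 h2
  have hU : ∀ y, y ∈ (PhyloTree.node Ta Tb la lb).leafSet ↔ y ∈ Ta.leafSet ∨ y ∈ Tb.leafSet := by
    intro y
    simp [leafSet]
  set Y := (PhyloTree.node Ta Tb la lb).leafSet \ {x'} with hY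
  have hmY : ∀ y, y ∈ Y ↔ (y ∈ Ta.leafSet ∨ y ∈ Tb.leafSet) ∧ y ≠ x' := by
    intro y
    rw [hY, Finset.mem_sdiff, hU, Finset.mem_singleton]
  have hxY : xstar ∈ Y := (hmY _).2 ⟨(hU _).1 hxs, hne.symm⟩
  have key := aux_some Y _ hpos
  obtain ⟨ha, hb, hpa, hpb⟩ := hpos
  rcases (hU x').1 hx' with hxa | hxb
  · have hfull : Tb.restrict? Y = some (0, Tb) :=
      aux_full Y Tb (fun y hy => (hmY y).2 ⟨Or.inr hy, by rintro rfl; exact hD _ hxa hy⟩)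
    rcases hl : Ta.restrict? Y with _ | ⟨ea, l'⟩
    · exfalso
      have hn' := aux_none Y Ta hl
      have : Ta.leafSet ⊆ {x'} := by
        intro y hy
        by_contra hc
        exact hn' y hy ((hmY y).2 ⟨Or.inl hy, by simpa using hc⟩)
      have := Finset.card_le_card this
      simp only [Finset.card_singleton] at this
      unfold numLeaves at *
      omega
    · have hres : (PhyloTree.node Ta Tb la lb).restrict? Y
          = some (0, PhyloTree.node l' Tb (la + ea) (lb + 0)) := by
        simp only [restrict?, hl, hfull]
      have hrt : (PhyloTree.node Ta Tb la lb).restrictTree Y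
          = PhyloTree.node l' Tb (la + ea) (lb + 0) := by
        simp only [restrictTree, hres]
      obtain ⟨-, k1, k2⟩ := key _ _ hres
      obtain ⟨-, m1, -⟩ := aux_some Y Ta hpa _ _ hl
      have hs := k2 xstar ((k1 _).2 ⟨hxs, hxY⟩)
      rw [zero_div, add_zero] at hs
      rw [hrt]
      have hsub : (Y.filter (fun z => (PhyloTree.node l' Tb (la + ea) (lb + 0)).FP xstar <
          (PhyloTree.node l' Tb (la + ea) (lb + 0)).FP z)) ⊆ Ta.leafSet.erase x' := by
        intro z hz
        rw [Finset.mem_filter] at hz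
        obtain ⟨hzY, hlt⟩ := hz
        obtain ⟨hz1, hz2⟩ := (hmY z).1 hzY
        rw [Finset.mem_erase]
        refine ⟨hz2, ?_⟩
        by_contra hza
        have hzb : z ∈ Tb.leafSet := by tauto
        have hzl : z ∉ l'.leafSet := fun hh => hza ((m1 z).1 hh).1
        have hzm := hmax z ((hU z).2 hz1)
        have e1 : (PhyloTree.node Ta Tb la lb).FP z = Tb.FP z + lb / (Tb.numLeaves : ℝ) := by
          simp only [FP, hza, hzb, if_true, if_false]
        have e2 : (PhyloTree.node l' Tb (la + ea) (lb + 0)).FP z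
            = Tb.FP z + lb / (Tb.numLeaves : ℝ) := by
          simp only [FP, hzl, hzb, if_true, if_false, add_zero]
        linarith
      have := Finset.card_le_card hsub
      rw [Finset.card_erase_of_mem hxa] at this
      exact this
  · have hfull : Ta.restrict? Y = some (0, Ta) :=
      aux_full Y Ta (fun y hy => (hmY y).2 ⟨Or.inl hy, by rintro rfl; exact hD _ hy hxb⟩)
    rcases hr : Tb.restrict? Y with _ | ⟨eb, r'⟩
    · have hn' := aux_none Y Tb hr
      have hrt : (PhyloTree.node Ta Tb la lb).restrictTree Y = Ta := by
        simp only [restrictTree, restrict?, hr, hfull]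
      rw [hrt]
      have hemp : (Y.filter (fun z => Ta.FP xstar < Ta.FP z)) = ∅ := by
        rw [Finset.filter_eq_empty_iff]
        intro z hzY hlt
        have hA : ∀ y ∈ Y, y ∈ Ta.leafSet := fun y hy =>
          (((hmY y).1 hy).1).resolve_right (fun hh => hn' y hh hy)
        have hzm := hmax z ((hU z).2 ((hmY z).1 hzY).1)
        simp only [FP, hA z hzY, hA xstar hxY, if_true] at hzm
        linarith
      rw [hemp, Finset.card_empty]
      exact Nat.zero_le _
    · have hres : (PhyloTree.node Ta Tb la lb).restrict? Y
          = some (0, PhyloTree.node Ta r' (la + 0) (lb + eb)) := by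
        simp only [restrict?, hr, hfull]
      have hrt : (PhyloTree.node Ta Tb la lb).restrictTree Y
          = PhyloTree.node Ta r' (la + 0) (lb + eb) := by
        simp only [restrictTree, hres]
      obtain ⟨-, k1, k2⟩ := key _ _ hres
      have hs := k2 xstar ((k1 _).2 ⟨hxs, hxY⟩)
      rw [zero_div, add_zero] at hs
      rw [hrt]
      have hsub : (Y.filter (fun z => (PhyloTree.node Ta r' (la + 0) (lb + eb)).FP xstar <
          (PhyloTree.node Ta r' (la + 0) (lb + eb)).FP z)) ⊆ Tb.leafSet.erase x' := by
        intro z hz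
        rw [Finset.mem_filter] at hz
        obtain ⟨hzY, hlt⟩ := hz
        obtain ⟨hz1, hz2⟩ := (hmY z).1 hzY
        rw [Finset.mem_erase]
        refine ⟨hz2, ?_⟩
        by_contra hzb
        have hza : z ∈ Ta.leafSet := by tauto
        have hzm := hmax z ((hU z).2 hz1)
        have e1 : (PhyloTree.node Ta Tb la lb).FP z = Ta.FP z + la / (Ta.numLeaves : ℝ) := by
          simp only [FP, hza, if_true]
        have e2 : (PhyloTree.node Ta r' (la + 0) (lb + eb)).FP z
            = Ta.FP z + la / (Ta.numLeaves : ℝ) := by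
          simp only [FP, hza, if_true, add_zero]
        linarith
      have := Finset.card_le_card hsub
      rw [Finset.card_erase_of_mem hxb] at this
      exact this.trans (Nat.sub_le_sub_right hab 1)
end

section
/- Let T = (T_a, T_b) be a rooted binary phylogenetic X-tree with strictly positive edge lengths and maximal pendant subtrees T_a and T_b with leaf sets X_a and X_b. Let X' ⊂ X be such that neither X_a ⊆ X' nor X_b ⊆ X', and let T̃ = T_{X∖X'} be the induced subtree on X̃ = X∖X'. Then FP_T(x) ≤ FP_{T̃}(x) for all x ∈ X̃. -/
open scoped Classical

open Phylo PhyloTree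

theorem restrict_none {α : Type} [DecidableEq α] (T : PhyloTree α) (Y : Finset α) :
    T.restrict? Y = none → ∀ x ∈ T.leafSet, x ∉ Y := by
  induction T with
  | leaf y =>
    intro h x hx
    simp only [leafSet, Finset.mem_singleton] at hx
    subst hx
    intro hy
    simp [restrict?, hy] at h
  | node l r a b ihl ihr =>
    intro h x hx
    simp only [leafSet, Finset.mem_union] at hx
    rcases hl : l.restrict? Y with _ | ⟨ea, l'⟩ <;> rcases hr : r.restrict? Y with _ | ⟨eb, r'⟩ <;>
      simp only [restrict?, hl, hr] at h
    · exact hx.elim (ihl hl x) (ihr hr x)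
    all_goals simp at h

theorem edge_aux (m n : ℕ) (c : ℝ) (hc : 0 ≤ c) (h0 : 0 < m) (h : m ≤ n) :
    c / (n : ℝ) ≤ c / (m : ℝ) := by
  have : (0 : ℝ) < m := by exact_mod_cast h0
  have : (m : ℝ) ≤ n := by exact_mod_cast h
  gcongr

theorem restrict_some {α : Type} [DecidableEq α] (T : PhyloTree α) (Y : Finset α) :
    T.distinctLeaves → T.posLengths → ∀ e t, T.restrict? Y = some (e, t) →
      (∀ x, x ∈ t.leafSet ↔ x ∈ T.leafSet ∧ x ∈ Y) ∧
      ∀ x ∈ t.leafSet, T.FP x ≤ t.FP x + e / (t.numLeaves : ℝ) := by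
  induction T with
  | leaf y =>
    intro _ _ e t h
    by_cases hy : y ∈ Y
    · simp only [restrict?, hy, if_true, Option.some.injEq, Prod.mk.injEq] at h
      obtain ⟨rfl, rfl⟩ := h
      refine ⟨fun x => ?_, fun x _ => by simp [FP]⟩
      simp only [leafSet, Finset.mem_singleton]
      constructor
      · rintro rfl; exact ⟨rfl, hy⟩
      · exact fun h => h.1
    · simp [restrict?, hy] at h
  | node l r a b ihl ihr =>
    rintro ⟨hd, dl, dr⟩ ⟨ha, hb, pl, pr⟩ e t h
    have key : ∀ (s s' : PhyloTree α), (∀ x, x ∈ s'.leafSet ↔ x ∈ s.leafSet ∧ x ∈ Y) →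
        ∀ c : ℝ, 0 < c → ∀ x ∈ s'.leafSet, c / (s.numLeaves : ℝ) ≤ c / (s'.numLeaves : ℝ) := by
      intro s s' hs c hc x hx
      apply edge_aux _ _ _ hc.le
      · exact Finset.card_pos.2 ⟨x, hx⟩
      · exact Finset.card_le_card fun z hz => ((hs z).1 hz).1
    have hdis : ∀ x, x ∈ r.leafSet → x ∉ l.leafSet :=
      fun x hr hl => Finset.disjoint_left.1 hd hl hr
    rcases hl : l.restrict? Y with _ | ⟨ea, l'⟩ <;> rcases hr : r.restrict? Y with _ | ⟨eb, r'⟩ <;>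
      simp only [restrict?, hl, hr, Option.some.injEq, Prod.mk.injEq, reduceCtorEq] at h
    · obtain ⟨rfl, rfl⟩ := h
      obtain ⟨h1, h2⟩ := ihr dr pr _ _ hr
      have hn := restrict_none l Y hl
      refine ⟨fun x => ?_, fun x hx => ?_⟩
      · rw [h1, leafSet, Finset.mem_union]
        have := hn x
        tauto
      · have hxr := ((h1 x).1 hx).1
        have k := key r r' h1 b hb x hx
        have k2 := h2 x hx
        simp only [FP, hdis x hxr, hxr, if_true, if_false]
        rw [add_div]; linarith
    · obtain ⟨rfl, rfl⟩ := h
      obtain ⟨h1, h2⟩ := ihl dl pl _ _ hl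
      have hn := restrict_none r Y hr
      refine ⟨fun x => ?_, fun x hx => ?_⟩
      · rw [h1, leafSet, Finset.mem_union]
        have := hn x
        tauto
      · have hxl := ((h1 x).1 hx).1
        have k := key l l' h1 a ha x hx
        have k2 := h2 x hx
        simp only [FP, hxl, if_true]
        rw [add_div]; linarith
    · obtain ⟨rfl, rfl⟩ := h
      obtain ⟨h1, h2⟩ := ihl dl pl _ _ hl
      obtain ⟨h3, h4⟩ := ihr dr pr _ _ hr
      refine ⟨fun x => ?_, fun x hx => ?_⟩
      · rw [leafSet, Finset.mem_union, h1, h3, leafSet, Finset.mem_union]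
        tauto
      · rw [leafSet, Finset.mem_union] at hx
        by_cases hx' : x ∈ l'.leafSet
        · have hxl := ((h1 x).1 hx').1
          have k := key l l' h1 a ha x hx'
          have k2 := h2 x hx'
          simp only [FP, hxl, hx', if_true]
          rw [add_div, zero_div]; linarith
        · have hx2 := hx.resolve_left hx'
          have hxr := ((h3 x).1 hx2).1
          have k := key r r' h3 b hb x hx2
          have k2 := h4 x hx2
          simp only [FP, hdis x hxr, hxr, hx', hx2, if_true, if_false]
          rw [add_div, zero_div]; linarith

/-- If `X' ⊂ X` contains neither all leaves of `T_a` nor all leaves of `T_b`,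
then the FP index of every surviving leaf does not decrease under the deletion of `X'`. -/
theorem fp_nondecreasing_under_deletion {α : Type} [DecidableEq α]
    (Ta Tb : PhyloTree α) (la lb : ℝ) (T : PhyloTree α)
    (hT : T = PhyloTree.node Ta Tb la lb)
    (hleaf : T.distinctLeaves) (hpos : T.posLengths)
    (X' : Finset α) (hX' : X' ⊂ T.leafSet)
    (hXa : ¬ Ta.leafSet ⊆ X') (hXb : ¬ Tb.leafSet ⊆ X') :
    ∀ x ∈ T.leafSet \ X', T.FP x ≤ (T.restrictTree (T.leafSet \ X')).FP x := by
  subst hT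
  intro x hx
  obtain ⟨p, hp, hpX⟩ := Finset.not_subset.1 hXa
  obtain ⟨q, hq, hqX⟩ := Finset.not_subset.1 hXb
  set T := PhyloTree.node Ta Tb la lb with hT
  set Y := T.leafSet \ X' with hY
  have hpY : p ∈ Y := by
    rw [hY, Finset.mem_sdiff, hT, leafSet, Finset.mem_union]; exact ⟨Or.inl hp, hpX⟩
  have hqY : q ∈ Y := by
    rw [hY, Finset.mem_sdiff, hT, leafSet, Finset.mem_union]; exact ⟨Or.inr hq, hqX⟩
  rcases hl : Ta.restrict? Y with _ | ⟨ea, l'⟩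
  · exact absurd hpY (restrict_none _ _ hl p hp)
  rcases hr : Tb.restrict? Y with _ | ⟨eb, r'⟩
  · exact absurd hqY (restrict_none _ _ hr q hq)
  have h : T.restrict? Y = some (0, PhyloTree.node l' r' (la + ea) (lb + eb)) := by
    simp only [hT, restrict?, hl, hr]
  obtain ⟨h1, h2⟩ := restrict_some T Y hleaf hpos _ _ h
  have := h2 x ((h1 x).2 ⟨(Finset.mem_sdiff.1 hx).1, hx⟩)
  rw [zero_div, add_zero] at this
  simpa only [restrictTree, h] using this
end

section
/- Let T be a rooted binary phylogenetic X-tree with |X| = n whose strictly positive edge lengths induce a ranking that is strict and reversible with respect to the deletion of a subset X' ⊂ X, and let d, k ∈ ℝ_{>0}. If all edge lengths of T are multiplied by k and subsequently d is added to all pendant edge lengths, then the resulting edge lengths also induce a ranking that is strict and reversible with respect to the deletion of X'. -/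
open scoped Classical

open Phylo PhyloTree

namespace PhyloAux
variable {α : Type} [DecidableEq α]

noncomputable def tr (k d : ℝ) (T : PhyloTree α) : PhyloTree α := (T.scale k).addPendant d

theorem isLeafB_scale (k : ℝ) (T : PhyloTree α) : (T.scale k).isLeafB = T.isLeafB := by
  cases T <;> rfl

theorem tr_leaf (k d : ℝ) (x : α) : tr k d (leaf x) = leaf x := rfl

theorem tr_node (k d : ℝ) (l r : PhyloTree α) (a b : ℝ) :
    tr k d (node l r a b) = node (tr k d l) (tr k d r)
      (k * a + if l.isLeafB then d else 0) (k * b + if r.isLeafB then d else 0) := by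
  simp only [tr, scale, addPendant, isLeafB_scale]
  congr 1 <;> split_ifs <;> simp

theorem leafSet_tr (k d : ℝ) (T : PhyloTree α) : (tr k d T).leafSet = T.leafSet := by
  induction T with
  | leaf x => rfl
  | node l r a b ihl ihr => simp only [tr_node, leafSet, ihl, ihr]

theorem FP_tr (k d : ℝ) (T : PhyloTree α) (x : α) (hx : x ∈ T.leafSet) :
    (tr k d T).FP x = k * T.FP x + if T.isLeafB then 0 else d := by
  induction T with
  | leaf y => simp [tr_leaf, FP, isLeafB]
  | node l r a b ihl ihr =>
    simp only [tr_node, FP, leafSet_tr, numLeaves]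
    by_cases h : x ∈ l.leafSet
    · simp only [h, if_true, ihl h]
      cases l <;> simp [isLeafB, leafSet] <;> ring
    · have h' : x ∈ r.leafSet := by
        simp only [leafSet, Finset.mem_union] at hx
        tauto
      simp only [h, h', if_true, if_false, ihr h']
      cases r <;> simp [isLeafB, leafSet] <;> ring

theorem restrict_tr (k d : ℝ) (T : PhyloTree α) (Y : Finset α) :
    (tr k d T).restrict? Y = (T.restrict? Y).map (fun p =>
      (k * p.1 + (if p.2.isLeafB then d else 0) - (if T.isLeafB then d else 0), tr k d p.2)) := by
  induction T with
  | leaf y =>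
    simp only [tr_leaf, restrict?]
    by_cases h : y ∈ Y <;> simp [h, isLeafB, tr_leaf]
  | node l r a b ihl ihr =>
    rw [tr_node]
    simp only [restrict?, ihl, ihr]
    rcases hl : l.restrict? Y with _ | ⟨ea, l'⟩ <;> rcases hr : r.restrict? Y with _ | ⟨eb, r'⟩ <;>
      simp [isLeafB, tr_node] <;> (try constructor) <;> ring

theorem restrictTree_tr (k d : ℝ) (T : PhyloTree α) (Y : Finset α) :
    (tr k d T).restrictTree Y = tr k d (T.restrictTree Y) := by
  simp only [restrictTree, restrict_tr]
  rcases T.restrict? Y with _ | ⟨e, t⟩ <;> rfl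

theorem mem_restrict (T : PhyloTree α) (Y : Finset α) (x : α) (hx : x ∈ T.leafSet) (hY : x ∈ Y) :
    ∃ e t, T.restrict? Y = some (e, t) ∧ x ∈ t.leafSet := by
  induction T with
  | leaf y =>
    simp only [leafSet, Finset.mem_singleton] at hx
    subst hx
    exact ⟨0, leaf x, by simp [restrict?, hY], by simp [leafSet]⟩
  | node l r a b ihl ihr =>
    simp only [leafSet, Finset.mem_union] at hx
    simp only [restrict?]
    rcases hx with hx | hx
    · obtain ⟨e, t, h, ht⟩ := ihl hx
      rw [h]
      rcases r.restrict? Y with _ | ⟨eb, r'⟩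
      · exact ⟨_, _, rfl, ht⟩
      · exact ⟨_, _, rfl, Finset.mem_union_left _ ht⟩
    · obtain ⟨e, t, h, ht⟩ := ihr hx
      rw [h]
      rcases l.restrict? Y with _ | ⟨eb, r'⟩
      · exact ⟨_, _, rfl, ht⟩
      · exact ⟨_, _, rfl, Finset.mem_union_right _ ht⟩

theorem mem_restrictTree (T : PhyloTree α) (Y : Finset α) (x : α) (hx : x ∈ T.leafSet)
    (hY : x ∈ Y) : x ∈ (T.restrictTree Y).leafSet := by
  obtain ⟨e, t, h, ht⟩ := mem_restrict T Y x hx hY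
  simpa only [restrictTree, h] using ht

end PhyloAux

/-- If the edge lengths of `T` induce a strict and reversible FP ranking with
respect to the deletion of `X'`, then so do the edge lengths obtained by multiplying all edge
lengths by `k > 0` and subsequently adding `d > 0` to all pendant edge lengths. -/
theorem strict_reversible_preserved_by_scale_and_pendant_shift {α : Type} [DecidableEq α]
    (T : PhyloTree α) (hleaf : T.distinctLeaves) (hpos : T.posLengths)
    (X' : Finset α) (hX' : X' ⊂ T.leafSet)
    (hstrict : T.strict) (hrev : T.reversible X')
    (d k : ℝ) (hd : 0 < d) (hk : 0 < k) :
    ((T.scale k).addPendant d).strict ∧ ((T.scale k).addPendant d).reversible X' := by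
  change (PhyloAux.tr k d T).strict ∧ (PhyloAux.tr k d T).reversible X'
  constructor
  · intro x hx y hy h
    rw [PhyloAux.leafSet_tr] at hx hy
    rw [PhyloAux.FP_tr k d T x hx, PhyloAux.FP_tr k d T y hy] at h
    exact hstrict hx hy (mul_left_cancel₀ hk.ne' (add_right_cancel h))
  · intro x hx y hy
    rw [PhyloAux.leafSet_tr] at hx hy ⊢
    have hx1 := (Finset.mem_sdiff.1 hx).1
    have hy1 := (Finset.mem_sdiff.1 hy).1
    rw [PhyloAux.restrictTree_tr, PhyloAux.FP_tr k d T x hx1, PhyloAux.FP_tr k d T y hy1,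
      PhyloAux.FP_tr k d _ x (PhyloAux.mem_restrictTree T _ x hx1 hx),
      PhyloAux.FP_tr k d _ y (PhyloAux.mem_restrictTree T _ y hy1 hy),
      add_lt_add_iff_right, add_lt_add_iff_right, mul_lt_mul_iff_right₀ hk,
      mul_lt_mul_iff_right₀ hk]
    exact hrev x hx y hy
end

section
/- Let T = (T_a, T_b) be a rooted binary phylogenetic X-tree with |X| = n ≥ 2 and strictly positive edge lengths, with maximal pendant subtrees T_a and T_b having leaf sets X_a and X_b. Let T̃ be the induced subtree obtained from T by deleting a set of leaves X' with ∅ ≠ X' ⊊ X_a (i.e. some but not all leaves of T_a, and none of T_b). Then FP_{T̃}(x) = FP_T(x) for all leaves x of T_b. -/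
open scoped Classical

open Phylo PhyloTree

theorem restrict_full {α : Type} [DecidableEq α] (Y : Finset α) :
    ∀ T : PhyloTree α, T.leafSet ⊆ Y → T.restrict? Y = some (0, T)
  | .leaf x, h => by
    have : x ∈ Y := h (by simp [leafSet])
    simp [restrict?, this]
  | .node l r a b, h => by
    simp only [leafSet] at h
    have h1 := restrict_full Y l (fun x hx => h (by simp [hx]))
    have h2 := restrict_full Y r (fun x hx => h (by simp [hx]))
    simp [restrict?, h1, h2]

theorem restrict_some_s14 {α : Type} [DecidableEq α] (Y : Finset α) (y : α) (hy : y ∈ Y) :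
    ∀ T : PhyloTree α, y ∈ T.leafSet → T.restrict? Y ≠ none
  | .leaf x, h => by
    have : y = x := by simpa [leafSet] using h
    subst this
    simp [restrict?, hy]
  | .node l r a b, h => by
    have h' : y ∈ l.leafSet ∨ y ∈ r.leafSet := by simpa [leafSet] using h
    have h1 := restrict_some_s14 Y y hy l
    have h2 := restrict_some_s14 Y y hy r
    rw [restrict?]
    rcases hl : l.restrict? Y with _ | ⟨ea, l'⟩ <;>
      rcases hr : r.restrict? Y with _ | ⟨eb, r'⟩ <;> simp
    exact h'.elim (fun q => h1 q hl) (fun q => h2 q hr)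

theorem restrict_sub {α : Type} [DecidableEq α] (Y : Finset α) :
    ∀ (T : PhyloTree α) (e : ℝ) (T' : PhyloTree α), T.restrict? Y = some (e, T') →
      ∀ x ∈ T'.leafSet, x ∈ T.leafSet
  | .leaf x, e, T', h => by
    rw [restrict?] at h
    split_ifs at h
    simp only [Option.some.injEq, Prod.mk.injEq] at h
    rw [← h.2]
    exact fun _ q => q
  | .node l r a b, e, T', h => by
    have h1 := restrict_sub Y l
    have h2 := restrict_sub Y r
    rw [restrict?] at h
    intro x hx
    rcases hl : l.restrict? Y with _ | ⟨ea, l'⟩ <;>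
      rcases hr : r.restrict? Y with _ | ⟨eb, r'⟩ <;> rw [hl, hr] at h <;>
      simp only [Option.some.injEq, Prod.mk.injEq, reduceCtorEq] at h
    · obtain ⟨-, rfl⟩ := h
      simp [leafSet, h2 _ _ hr x hx]
    · obtain ⟨-, rfl⟩ := h
      simp [leafSet, h1 _ _ hl x hx]
    · obtain ⟨-, rfl⟩ := h
      have hx' : x ∈ l'.leafSet ∨ x ∈ r'.leafSet := by simpa [leafSet] using hx
      rcases hx' with q | q
      · simp [leafSet, h1 _ _ hl x q]
      · simp [leafSet, h2 _ _ hr x q]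

/-- If some, but not all, leaves of `T_a` (and no leaf of `T_b`) are deleted
from `T = (T_a, T_b)`, then the FP index of every leaf of `T_b` is unchanged. -/
theorem fp_unchanged_in_unaffected_subtree {α : Type} [DecidableEq α]
    (Ta Tb : PhyloTree α) (la lb : ℝ) (T : PhyloTree α)
    (hT : T = PhyloTree.node Ta Tb la lb)
    (hleaf : T.distinctLeaves) (hpos : T.posLengths)
    (X' : Finset α) (hne : X'.Nonempty) (hX' : X' ⊂ Ta.leafSet) :
    ∀ x ∈ Tb.leafSet,
      (T.restrictTree (T.leafSet \ X')).FP x = T.FP x := by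
  subst hT
  intro x hx
  have hd : Disjoint Ta.leafSet Tb.leafSet := hleaf.1
  obtain ⟨y, hy, hyX⟩ := Finset.exists_of_ssubset hX'
  have hxa : x ∉ Ta.leafSet := fun q => Finset.disjoint_left.mp hd q hx
  generalize hY : (PhyloTree.node Ta Tb la lb).leafSet \ X' = Y
  have hyY : y ∈ Y := by rw [← hY]; simp [leafSet, hy, hyX]
  have hb : Tb.leafSet ⊆ Y := by
    intro z hz
    have : z ∉ X' := fun q => Finset.disjoint_left.mp hd (hX'.1 q) hz
    rw [← hY]; simp [leafSet, hz, this]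
  have hr := restrict_full Y Tb hb
  rcases hl : Ta.restrict? Y with _ | ⟨ea, l'⟩
  · exact absurd hl (restrict_some_s14 Y y hyY Ta hy)
  · have hxl : x ∉ l'.leafSet := fun q => hxa (restrict_sub Y Ta ea l' hl x q)
    simp [restrictTree, restrict?, hl, hr, FP, hxl, hxa, hx]
end
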